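/- arXiv:1011.1186 — 2 statements merged into one kernel-verified Lean document; each statement's English description precedes it below -/
import Mathlib

section
/- Let r > 0, set q = e^{−π√r}, and assume k_r ∈ (0,1) satisfies K(√(1 − k_r²)) = √r · K(k_r). Then for every positive integer ν, k_r = tanh( 4·∑_{j=0}^{ν−1} arctanh(q^{j+1/2}) + log( ((−q^{ν+1/2};q)_∞/(q^{ν+1/2};q)_∞)² ) ). -/
/-- The q-Pochhammer infinite product `(a; q)_∞ = ∏_{n=0}^∞ (1 - a qⁿ)`. -/
noncomputable def qPoch (a q : ℝ) : ℝ := ∏' n : ℕ, (1 - a * q ^ n)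
/-- The complete elliptic integral of the first kind
`K(x) = ∫₀^{π/2} dt / √(1 - x² sin² t)`. -/
noncomputable def Kint (x : ℝ) : ℝ :=
  ∫ t in (0 : ℝ)..(Real.pi / 2), 1 / Real.sqrt (1 - x ^ 2 * Real.sin t ^ 2)
/-- The inverse hyperbolic tangent. -/
noncomputable def arctanh (x : ℝ) : ℝ := Real.log ((1 + x) / (1 - x)) / 2


noncomputable def ellI (a b : ℝ) : ℝ :=
  ∫ t in (0 : ℝ)..(Real.pi / 2), 1 / Real.sqrt (a ^ 2 * Real.cos t ^ 2 + b ^ 2 * Real.sin t ^ 2)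

lemma ell_pos {a b : ℝ} (ha : 0 < a) (hb : 0 < b) (t : ℝ) :
    0 < a ^ 2 * Real.cos t ^ 2 + b ^ 2 * Real.sin t ^ 2 := by
  have h := Real.sin_sq_add_cos_sq t
  by_cases hc : Real.cos t = 0
  · have : Real.sin t ^ 2 = 1 := by rw [hc] at h; linarith
    rw [hc, this]; positivity
  · positivity

lemma ell_pos' {a b : ℝ} (ha : 0 < a) (hb : 0 < b) (t : ℝ) :
    0 < a * Real.cos t ^ 2 + b * Real.sin t ^ 2 := by
  have := ell_pos (Real.sqrt_pos.2 ha) (Real.sqrt_pos.2 hb) t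
  rwa [Real.sq_sqrt ha.le, Real.sq_sqrt hb.le] at this

lemma ell_cont {a b : ℝ} (ha : 0 < a) (hb : 0 < b) :
    Continuous fun t => 1 / Real.sqrt (a ^ 2 * Real.cos t ^ 2 + b ^ 2 * Real.sin t ^ 2) := by
  refine continuous_const.div (by fun_prop) fun t => ?_
  exact (Real.sqrt_pos.2 (ell_pos ha hb t)).ne'

lemma ell_double {a b : ℝ} (ha : 0 < a) (hb : 0 < b) :
    ∫ t in (0 : ℝ)..Real.pi, 1 / Real.sqrt (a ^ 2 * Real.cos t ^ 2 + b ^ 2 * Real.sin t ^ 2)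
      = 2 * ellI a b := by
  have hc := ell_cont ha hb
  rw [← intervalIntegral.integral_add_adjacent_intervals (b := Real.pi / 2)
    (hc.intervalIntegrable _ _) (hc.intervalIntegrable _ _), two_mul]
  congr 1
  have := intervalIntegral.integral_comp_sub_left (a := 0) (b := Real.pi / 2)
    (fun t => 1 / Real.sqrt (a ^ 2 * Real.cos t ^ 2 + b ^ 2 * Real.sin t ^ 2)) Real.pi
  rw [sub_zero, show Real.pi - Real.pi / 2 = Real.pi / 2 by ring] at this
  rw [← this, ellI]
  simp [Real.cos_pi_sub, Real.sin_pi_sub]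

lemma ell_gauss {a b : ℝ} (ha : 0 < a) (hb : 0 < b) :
    ellI ((a + b) / 2) (Real.sqrt (a * b)) = ellI a b := by
  have ha1 : 0 < (a + b) / 2 := by positivity
  have hb1 : 0 < Real.sqrt (a * b) := by positivity
  have h2 := ell_double ha1 hb1
  set w : ℝ → ℝ := fun t => (b - a) * Real.sin t * Real.cos t with hw
  set v : ℝ → ℝ := fun t => a * Real.cos t ^ 2 + b * Real.sin t ^ 2 with hv
  have hvp : ∀ t, 0 < v t := ell_pos' ha hb
  set D : ℝ → ℝ := fun t => a ^ 2 * Real.cos t ^ 2 + b ^ 2 * Real.sin t ^ 2 with hD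
  have hDp : ∀ t, 0 < D t := ell_pos ha hb
  have hvw : ∀ t, v t ^ 2 + w t ^ 2 = D t := by
    intro t
    simp only [hv, hw, hD, Real.cos_sq']
    ring_nf
    have : Real.cos t ^ 2 = 1 - Real.sin t ^ 2 := Real.cos_sq' t
    simp only [this]; ring
  set f : ℝ → ℝ := fun t => 2 * t + Real.arctan (w t / v t) with hf
  set f' : ℝ → ℝ := fun t => (D t + a * b) / D t with hf'
  have hder : ∀ t, HasDerivAt f (f' t) t := by
    intro t
    have hs := Real.hasDerivAt_sin t
    have hcs := Real.hasDerivAt_cos t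
    have hwd : HasDerivAt w ((b - a) * Real.cos t * Real.cos t + (b - a) * Real.sin t * (-Real.sin t)) t :=
      (hs.const_mul (b - a)).mul hcs
    have hvd : HasDerivAt v (a * (2 * Real.cos t * (-Real.sin t)) + b * (2 * Real.sin t * Real.cos t)) t := by
      have := ((hcs.pow 2).const_mul a).add ((hs.pow 2).const_mul b)
      refine this.congr_deriv ?_
      simp
    have := ((hasDerivAt_id t).const_mul 2).add ((hwd.div hvd (hvp t).ne').arctan)
    refine this.congr_deriv ?_
    have h1 : 1 + (w t / v t) ^ 2 = D t / v t ^ 2 := by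
      rw [← hvw t]; have := (hvp t).ne'; field_simp
    rw [Pi.div_apply, h1]
    simp only [hf']
    have h3 := (hvp t).ne'
    have h4 := (hDp t).ne'
    field_simp
    simp only [hv, hw, hD]
    have : Real.cos t ^ 2 = 1 - Real.sin t ^ 2 := Real.cos_sq' t
    ring_nf
    simp only [this, show Real.cos t ^ 4 = (Real.cos t ^ 2) ^ 2 by ring]; ring
  have hDc : Continuous D := by fun_prop
  have hf'c : Continuous f' := (hDc.add continuous_const).div hDc fun t => (hDp t).ne'
  have hsub := intervalIntegral.integral_comp_mul_deriv (a := 0) (b := Real.pi / 2)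
    (fun t _ => hder t) hf'c.continuousOn (ell_cont ha1 hb1)
  have hf0 : f 0 = 0 := by simp [hf, hw]
  have hf1 : f (Real.pi / 2) = Real.pi := by simp [hf, hw]; ring
  rw [hf0, hf1, h2] at hsub
  have key : ∀ t, ((fun t => 1 / Real.sqrt (((a + b) / 2) ^ 2 * Real.cos t ^ 2 + Real.sqrt (a * b) ^ 2 * Real.sin t ^ 2)) ∘ f) t * f' t
      = 2 * (1 / Real.sqrt (D t)) := by
    intro t
    have hsD : 0 < Real.sqrt (D t) := Real.sqrt_pos.2 (hDp t)
    have hsq : Real.sqrt (D t) ^ 2 = D t := Real.sq_sqrt (hDp t).le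
    have h3 := hvp t
    have h1 : Real.sqrt (1 + (w t / v t) ^ 2) = Real.sqrt (D t) / v t := by
      rw [← Real.sqrt_sq h3.le, ← Real.sqrt_div (hDp t).le, ← hvw t, Real.sqrt_sq h3.le]
      congr 1; field_simp
    have hc : Real.cos (f t) = (a * Real.cos t ^ 2 - b * Real.sin t ^ 2) / Real.sqrt (D t) := by
      simp only [hf]
      rw [Real.cos_add, Real.cos_arctan, Real.sin_arctan, h1, Real.cos_two_mul, Real.sin_two_mul]
      field_simp
      simp only [hv, hw]
      ring_nf
      have : Real.sin t ^ 2 = 1 - Real.cos t ^ 2 := Real.sin_sq t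
      simp only [this]; ring
    have hs : Real.sin (f t) = ((a + b) * Real.sin t * Real.cos t) / Real.sqrt (D t) := by
      simp only [hf]
      rw [Real.sin_add, Real.cos_arctan, Real.sin_arctan, h1, Real.cos_two_mul, Real.sin_two_mul]
      field_simp
      simp only [hv, hw]
      ring_nf
      have : Real.sin t ^ 3 = Real.sin t * (1 - Real.cos t ^ 2) := by rw [← Real.sin_sq t]; ring
      simp only [this]; ring
    have hR : ((a + b) / 2) ^ 2 * Real.cos (f t) ^ 2 + Real.sqrt (a * b) ^ 2 * Real.sin (f t) ^ 2
        = ((D t + a * b) / (2 * Real.sqrt (D t))) ^ 2 := by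
      rw [hc, hs, Real.sq_sqrt (by positivity)]
      have : D t + a * b = (a + b) * v t := by
        simp only [hD, hv, Real.cos_sq']; ring
      rw [this]
      field_simp
      simp only [hv]
      ring
    simp only [Function.comp]
    have hp : 0 < D t + a * b := by have := hDp t; positivity
    rw [hR, Real.sqrt_sq (by positivity)]
    simp only [hf']
    have h4 := hDp t
    field_simp
    rw [hsq]
  have : ∫ t in (0:ℝ)..(Real.pi / 2), ((fun t => 1 / Real.sqrt (((a + b) / 2) ^ 2 * Real.cos t ^ 2 + Real.sqrt (a * b) ^ 2 * Real.sin t ^ 2)) ∘ f) t * f' t = 2 * ellI a b := by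
    rw [intervalIntegral.integral_congr (fun t _ => key t), intervalIntegral.integral_const_mul, ellI]
  linarith

lemma ell_scale {a b c : ℝ} (hc : 0 < c) : ellI (c * a) (c * b) = ellI a b / c := by
  rw [ellI, ellI, ← intervalIntegral.integral_div]
  congr 1; ext t
  rw [show (c * a) ^ 2 * Real.cos t ^ 2 + (c * b) ^ 2 * Real.sin t ^ 2 =
    c ^ 2 * (a ^ 2 * Real.cos t ^ 2 + b ^ 2 * Real.sin t ^ 2) by ring, Real.sqrt_mul (by positivity),
    Real.sqrt_sq hc.le]
  rw [div_div, mul_comm]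

lemma ell_tendsto {u v : ℕ → ℝ} (hu : ∀ n, 0 < u n) (hv : ∀ n, 0 < v n)
    (hu1 : Filter.Tendsto u Filter.atTop (nhds 1)) (hv1 : Filter.Tendsto v Filter.atTop (nhds 1)) :
    Filter.Tendsto (fun n => ellI (u n) (v n)) Filter.atTop (nhds (Real.pi / 2)) := by
  have hmax : Filter.Tendsto (fun n => 1 / max (u n) (v n) * (Real.pi / 2)) Filter.atTop
      (nhds (Real.pi / 2)) := by
    have := ((tendsto_const_nhds (x := (1:ℝ))).div (hu1.max hv1) (by simp)).mul_const (Real.pi / 2)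
    simpa using this
  have hmin : Filter.Tendsto (fun n => 1 / min (u n) (v n) * (Real.pi / 2)) Filter.atTop
      (nhds (Real.pi / 2)) := by
    have := ((tendsto_const_nhds (x := (1:ℝ))).div (hu1.min hv1) (by simp)).mul_const (Real.pi / 2)
    simpa using this
  have hpi := Real.pi_pos
  refine tendsto_of_tendsto_of_tendsto_of_le_of_le hmax hmin (fun n => ?_) (fun n => ?_)
  · have : ∫ t in (0:ℝ)..(Real.pi / 2), (1 / max (u n) (v n)) = 1 / max (u n) (v n) * (Real.pi / 2) := by
      simp [mul_comm]
    show _ ≤ ellI _ _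
    rw [← this]
    apply intervalIntegral.integral_mono (by positivity) (by simp) ((ell_cont (hu n) (hv n)).intervalIntegrable _ _)
    intro t
    have hp := Real.sqrt_pos.2 (ell_pos (hu n) (hv n) t)
    have hM : 0 < max (u n) (v n) := lt_max_of_lt_left (hu n)
    apply one_div_le_one_div_of_le hp
    apply Real.sqrt_le_iff.2 ⟨hM.le, ?_⟩
    have h1 : u n ^ 2 ≤ max (u n) (v n) ^ 2 := pow_le_pow_left₀ (hu n).le (le_max_left _ _) 2
    have h2 : v n ^ 2 ≤ max (u n) (v n) ^ 2 := pow_le_pow_left₀ (hv n).le (le_max_right _ _) 2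
    nlinarith [Real.sin_sq_add_cos_sq t, sq_nonneg (Real.sin t), sq_nonneg (Real.cos t)]
  · have : ∫ t in (0:ℝ)..(Real.pi / 2), (1 / min (u n) (v n)) = 1 / min (u n) (v n) * (Real.pi / 2) := by
      simp [mul_comm]
    show ellI _ _ ≤ _
    rw [← this]
    apply intervalIntegral.integral_mono (by positivity) ((ell_cont (hu n) (hv n)).intervalIntegrable _ _) (by simp)
    intro t
    have hM : 0 < min (u n) (v n) := lt_min (hu n) (hv n)
    apply one_div_le_one_div_of_le hM
    apply Real.le_sqrt_of_sq_le
    have h1 : min (u n) (v n) ^ 2 ≤ u n ^ 2 := pow_le_pow_left₀ hM.le (min_le_left _ _) 2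
    have h2 : min (u n) (v n) ^ 2 ≤ v n ^ 2 := pow_le_pow_left₀ hM.le (min_le_right _ _) 2
    nlinarith [Real.sin_sq_add_cos_sq t, sq_nonneg (Real.sin t), sq_nonneg (Real.cos t)]

noncomputable def th3 (s : ℝ) : ℝ := ∑' n : ℤ, Real.exp (-Real.pi * s * (n : ℝ) ^ 2)
noncomputable def th4 (s : ℝ) : ℝ := ∑' n : ℤ, (-1 : ℝ) ^ n * Real.exp (-Real.pi * s * (n : ℝ) ^ 2)
noncomputable def th2 (s : ℝ) : ℝ := ∑' n : ℤ, Real.exp (-Real.pi * s * ((n : ℝ) + 1 / 2) ^ 2)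

lemma summ3 {s : ℝ} (hs : 0 < s) : Summable fun n : ℤ => Real.exp (-Real.pi * s * (n : ℝ) ^ 2) := by
  have := summable_pow_mul_jacobiTheta₂_term_bound 0 hs 0
  simpa [mul_assoc] using this

lemma summ2 {s : ℝ} (hs : 0 < s) :
    Summable fun n : ℤ => Real.exp (-Real.pi * s * ((n : ℝ) + 1 / 2) ^ 2) := by
  have := summable_pow_mul_jacobiTheta₂_term_bound (s / 2) hs 0
  refine this.of_nonneg_of_le (fun n => (Real.exp_pos _).le) fun n => ?_
  rw [pow_zero, one_mul, Real.exp_le_exp]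
  have h1 := neg_abs_le (n : ℝ)
  have h2 := mul_pos Real.pi_pos hs
  push_cast
  nlinarith [mul_nonneg h2.le (show 0 ≤ (n : ℝ) + |(n : ℝ)| by linarith)]

lemma abs_sgn (n : ℤ) : |(-1 : ℝ) ^ n| = 1 := by
  simp [abs_zpow]

lemma summ4 {s : ℝ} (hs : 0 < s) :
    Summable fun n : ℤ => (-1 : ℝ) ^ n * Real.exp (-Real.pi * s * (n : ℝ) ^ 2) := by
  refine (summ3 hs).of_norm_bounded fun n => ?_
  rw [norm_mul, Real.norm_eq_abs, abs_sgn, one_mul, Real.norm_eq_abs, abs_of_pos (Real.exp_pos _)]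

lemma th3_pos {s : ℝ} (hs : 0 < s) : 0 < th3 s :=
  (summ3 hs).tsum_pos (fun _ => (Real.exp_pos _).le) 0 (Real.exp_pos _)

lemma th2_pos {s : ℝ} (hs : 0 < s) : 0 < th2 s :=
  (summ2 hs).tsum_pos (fun _ => (Real.exp_pos _).le) 0 (Real.exp_pos _)

lemma th3_inv {s : ℝ} (hs : 0 < s) : th3 s ^ 2 = 1 / s * th3 (1 / s) ^ 2 := by
  have := Real.tsum_exp_neg_mul_int_sq hs
  rw [th3, this, th3, mul_pow, ← Real.sqrt_eq_rpow, div_pow, one_pow, Real.sq_sqrt hs.le]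
  simp [div_eq_mul_inv]

lemma th4_inv' {s : ℝ} (hs : 0 < s) : th4 s = 1 / Real.sqrt s * th2 (1 / s) := by
  have := Complex.tsum_exp_neg_quadratic (a := (s : ℂ)) (by simpa using hs) (Complex.I / 2)
  have e1 : ∀ n : ℤ, Complex.exp (-Real.pi * s * n ^ 2 + 2 * Real.pi * (Complex.I / 2) * n)
      = (((-1 : ℝ) ^ n * Real.exp (-Real.pi * s * (n : ℝ) ^ 2) : ℝ) : ℂ) := by
    intro n
    rw [Complex.exp_add, show 2 * (Real.pi : ℂ) * (Complex.I / 2) * n = n * (Real.pi * Complex.I) by ring,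
      Complex.exp_int_mul, Complex.exp_pi_mul_I]
    push_cast
    ring
  have e2 : ∀ n : ℤ, Complex.exp (-Real.pi / s * (n + Complex.I * (Complex.I / 2)) ^ 2)
      = ((Real.exp (-Real.pi * (1 / s) * (((n - 1 : ℤ) : ℝ) + 1 / 2) ^ 2) : ℝ) : ℂ) := by
    intro n
    push_cast
    congr 1
    rw [← mul_div_assoc, Complex.I_mul_I]
    ring
  simp_rw [e1, e2] at this
  rw [← Complex.ofReal_tsum, ← Complex.ofReal_tsum,
    show (1 / 2 : ℂ) = ((1 / 2 : ℝ) : ℂ) by push_cast; rfl, ← Complex.ofReal_cpow hs.le] at this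
  have h2 : ∑' n : ℤ, Real.exp (-Real.pi * (1 / s) * (((n - 1 : ℤ) : ℝ) + 1 / 2) ^ 2) = th2 (1 / s) :=
    (Equiv.subRight (1 : ℤ)).tsum_eq (fun n : ℤ => Real.exp (-Real.pi * (1 / s) * ((n : ℝ) + 1 / 2) ^ 2))
  rw [h2] at this
  rw [th4, Real.sqrt_eq_rpow]
  exact_mod_cast this

lemma th4_pos {s : ℝ} (hs : 0 < s) : 0 < th4 s := by
  rw [th4_inv' hs]
  have := th2_pos (s := 1 / s) (by positivity)
  positivity

lemma th4_inv {s : ℝ} (hs : 0 < s) : th4 (1 / s) ^ 2 = s * th2 s ^ 2 := by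
  rw [th4_inv' (by positivity), mul_pow, div_pow, Real.sq_sqrt (by positivity)]
  simp

lemma split_sum {f : ℤ × ℤ → ℝ} (hf : Summable f) :
    ∑' p, f p = (∑' p : ℤ × ℤ, f (p.1 + p.2, p.1 - p.2)) +
      ∑' p : ℤ × ℤ, f (p.1 + p.2 + 1, p.1 - p.2) := by
  have hi : Function.Injective fun p : ℤ × ℤ => (p.1 + p.2, p.1 - p.2) := by
    rintro ⟨a, b⟩ ⟨c, d⟩ h
    simp only [Prod.mk.injEq] at h ⊢
    omega
  have hj : Function.Injective fun p : ℤ × ℤ => (p.1 + p.2 + 1, p.1 - p.2) := by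
    rintro ⟨a, b⟩ ⟨c, d⟩ h
    simp only [Prod.mk.injEq] at h ⊢
    omega
  have h1 := hi.hasSum_range_iff.2 (hf.comp_injective hi).hasSum
  have h2 := hj.hasSum_range_iff.2 (hf.comp_injective hj).hasSum
  refine (h1.add_isCompl ?_ h2).tsum_eq
  rw [isCompl_iff, disjoint_iff, codisjoint_iff]
  constructor
  · ext ⟨m, n⟩
    simp only [Set.inf_eq_inter, Set.mem_inter_iff, Set.mem_range, Prod.exists, Prod.mk.injEq, Set.bot_eq_empty, Set.mem_empty_iff_false, iff_false]
    rintro ⟨⟨a, b, h1⟩, ⟨c, d, h2⟩⟩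
    omega
  · ext ⟨m, n⟩
    simp only [Set.sup_eq_union, Set.mem_union, Set.mem_range, Prod.exists, Prod.mk.injEq, Set.top_eq_univ, Set.mem_univ, iff_true]
    rcases Int.emod_two_eq_zero_or_one (m + n) with h | h
    · exact Or.inl ⟨(m + n) / 2, (m - n) / 2, by omega, by omega⟩
    · exact Or.inr ⟨(m - 1 + n) / 2, (m - 1 - n) / 2, by omega, by omega⟩

lemma sgn_add (a b : ℤ) : (-1 : ℝ) ^ (a + b) = (-1) ^ a * (-1) ^ b := zpow_add₀ (by norm_num) a b
lemma sgn_sub (a b : ℤ) : (-1 : ℝ) ^ (a - b) = (-1) ^ a * (-1) ^ b := by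
  rw [zpow_sub₀ (by norm_num), div_eq_mul_inv, ← inv_zpow]; norm_num
lemma sgn_sq (a : ℤ) : (-1 : ℝ) ^ a * (-1) ^ a = 1 := by
  rw [← sgn_sub, sub_self, zpow_zero]

lemma sgn2 (a b : ℤ) : (-1 : ℝ) ^ a * (-1) ^ b * ((-1) ^ a * (-1) ^ b) = 1 := by
  rw [mul_mul_mul_comm, sgn_sq, sgn_sq, one_mul]
lemma sgn3 (a b : ℤ) : (-1 : ℝ) ^ a * (-1) ^ b * (-1) ^ (1 : ℤ) * ((-1) ^ a * (-1) ^ b) = -1 := by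
  rw [mul_right_comm, sgn2]; norm_num
lemma mul_tsum {f g : ℤ → ℝ} (hf : Summable f) (hg : Summable g) :
    (∑' n, f n) * (∑' n, g n) = ∑' p : ℤ × ℤ, f p.1 * g p.2 :=
  tsum_mul_tsum_of_summable_norm hf.norm hg.norm
lemma mul_summ {f g : ℤ → ℝ} (hf : Summable f) (hg : Summable g) :
    Summable fun p : ℤ × ℤ => f p.1 * g p.2 :=
  summable_mul_of_summable_norm hf.norm hg.norm

lemma th3_sq {s : ℝ} (hs : 0 < s) : th3 s ^ 2 = th3 (2 * s) ^ 2 + th2 (2 * s) ^ 2 := by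
  have hs2 : 0 < 2 * s := by positivity
  rw [sq, sq, sq, th3, mul_tsum (summ3 hs) (summ3 hs), split_sum (mul_summ (summ3 hs) (summ3 hs)),
    th3, mul_tsum (summ3 hs2) (summ3 hs2), th2, mul_tsum (summ2 hs2) (summ2 hs2)]
  congr 1 <;>
  · congr 1; ext ⟨a, b⟩
    simp only [← Real.exp_add]
    push_cast
    congr 1
    ring

lemma th4_sq {s : ℝ} (hs : 0 < s) : th4 s ^ 2 = th3 (2 * s) ^ 2 - th2 (2 * s) ^ 2 := by
  have hs2 : 0 < 2 * s := by positivity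
  rw [sq, sq, sq, th4, mul_tsum (summ4 hs) (summ4 hs), split_sum (mul_summ (summ4 hs) (summ4 hs)),
    th3, mul_tsum (summ3 hs2) (summ3 hs2), th2, mul_tsum (summ2 hs2) (summ2 hs2), sub_eq_add_neg,
    ← tsum_neg]
  congr 1
  · congr 1; ext ⟨a, b⟩
    simp only [sgn_add, sgn_sub]
    rw [← Real.exp_add, mul_mul_mul_comm, ← Real.exp_add, sgn2, one_mul]
    push_cast
    congr 1
    ring
  · congr 1; ext ⟨a, b⟩
    simp only [sgn_add, sgn_sub]
    rw [← Real.exp_add, mul_mul_mul_comm, ← Real.exp_add, sgn3, neg_one_mul]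
    push_cast
    congr 2
    ring

lemma th34 {s : ℝ} (hs : 0 < s) : th3 s * th4 s = th4 (2 * s) ^ 2 := by
  have hs2 : 0 < 2 * s := by positivity
  rw [sq, th3, th4, mul_tsum (summ3 hs) (summ4 hs), split_sum (mul_summ (summ3 hs) (summ4 hs)),
    th4, mul_tsum (summ4 hs2) (summ4 hs2)]
  have h0 : ∑' p : ℤ × ℤ, Real.exp (-Real.pi * s * ((p.1 + p.2 + 1 : ℤ) : ℝ) ^ 2) *
      ((-1 : ℝ) ^ (p.1 - p.2) * Real.exp (-Real.pi * s * ((p.1 - p.2 : ℤ) : ℝ) ^ 2)) = 0 := by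
    set F : ℤ × ℤ → ℝ := fun p => Real.exp (-Real.pi * s * ((p.1 + p.2 + 1 : ℤ) : ℝ) ^ 2) *
      ((-1 : ℝ) ^ (p.1 - p.2) * Real.exp (-Real.pi * s * ((p.1 - p.2 : ℤ) : ℝ) ^ 2)) with hF
    have h1 := (Equiv.prodCongr (Equiv.subLeft (-1 : ℤ)) (Equiv.refl ℤ)).tsum_eq F
    have h2 : ∀ p, F (Equiv.prodCongr (Equiv.subLeft (-1 : ℤ)) (Equiv.refl ℤ) p) = - F p := by
      rintro ⟨a, b⟩
      simp only [hF, Equiv.prodCongr_apply, Prod.map, Equiv.subLeft_apply, Equiv.refl_apply, sgn_sub]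
      rw [mul_left_comm, ← Real.exp_add, mul_left_comm, ← Real.exp_add]
      rw [← neg_mul]
      congr 1
      · simp
      · push_cast; congr 1; ring
    simp_rw [h2, tsum_neg] at h1
    linarith
  rw [h0, add_zero]
  congr 1; ext ⟨a, b⟩
  simp only [sgn_sub]
  rw [mul_left_comm, ← Real.exp_add, mul_mul_mul_comm, ← Real.exp_add]
  push_cast
  congr 2
  ring

lemma th_lim {s : ℝ} (hs : 0 < s) (e : ℤ → ℝ) (he : ∀ n, |e n| ≤ 1) (he0 : e 0 = 1) :
    Filter.Tendsto (fun m : ℕ => ∑' n : ℤ, e n * Real.exp (-Real.pi * (2 ^ m * s) * (n : ℝ) ^ 2))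
      Filter.atTop (nhds 1) := by
  have h : (1 : ℝ) = ∑' n : ℤ, if n = 0 then (1 : ℝ) else 0 := by simp
  rw [h]
  refine tendsto_tsum_of_dominated_convergence (summ3 hs) (fun n => ?_) (.of_forall fun m n => ?_)
  · by_cases hn : n = 0
    · simp [hn, he0]
    · rw [if_neg hn, ← mul_zero (e n)]
      refine Filter.Tendsto.const_mul _ (Real.tendsto_exp_atBot.comp ?_)
      have h1 : Filter.Tendsto (fun m : ℕ => (2 : ℝ) ^ m) Filter.atTop Filter.atTop :=
        tendsto_pow_atTop_atTop_of_one_lt (by norm_num)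
      have hn' : (n : ℝ) ≠ 0 := by exact_mod_cast hn
      have hc : -Real.pi * s * (n : ℝ) ^ 2 < 0 := by
        have := mul_pos (mul_pos Real.pi_pos hs) (sq_pos_of_ne_zero hn' : 0 < (n : ℝ) ^ 2)
        linarith
      refine (h1.const_mul_atTop_of_neg hc).congr fun m => ?_
      ring
  · rw [norm_mul, Real.norm_eq_abs, Real.norm_eq_abs, abs_of_pos (Real.exp_pos _)]
    refine (mul_le_of_le_one_left (Real.exp_pos _).le (he n)).trans ?_
    rw [Real.exp_le_exp]
    have h1 : (1 : ℝ) ≤ 2 ^ m := one_le_pow₀ (by norm_num)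
    have h2 : 0 ≤ Real.pi * s * (n : ℝ) ^ 2 := by positivity
    nlinarith

lemma th3_lim {s : ℝ} (hs : 0 < s) :
    Filter.Tendsto (fun m : ℕ => th3 (2 ^ m * s)) Filter.atTop (nhds 1) := by
  simpa [th3] using th_lim hs (fun _ => 1) (by simp) rfl
lemma th4_lim {s : ℝ} (hs : 0 < s) :
    Filter.Tendsto (fun m : ℕ => th4 (2 ^ m * s)) Filter.atTop (nhds 1) := by
  simpa [th4] using th_lim hs (fun n => (-1) ^ n) (fun n => (abs_sgn n).le) (by simp)


lemma qP_summ (a : ℝ) {q : ℝ} (h0 : 0 < q) (h1 : q < 1) : Summable fun n : ℕ => -(a * q ^ n) :=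
  ((summable_geometric_of_lt_one h0.le h1).mul_left a).neg

lemma qP_mult (a : ℝ) {q : ℝ} (h0 : 0 < q) (h1 : q < 1) :
    Multipliable fun n : ℕ => 1 - a * q ^ n := by
  simpa [sub_eq_add_neg] using multipliable_one_add_of_summable (qP_summ a h0 h1).norm

lemma qP_tendsto (a : ℝ) {q : ℝ} (h0 : 0 < q) (h1 : q < 1) :
    Filter.Tendsto (fun N => ∏ j ∈ Finset.range N, (1 - a * q ^ j)) Filter.atTop (nhds (qPoch a q)) :=
  (qP_mult a h0 h1).hasProd.tendsto_prod_nat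

lemma qP_split (a : ℝ) {q : ℝ} (h0 : 0 < q) (h1 : q < 1) (N : ℕ) :
    qPoch a q = (∏ j ∈ Finset.range N, (1 - a * q ^ j)) * qPoch (a * q ^ N) q := by
  have h : Multipliable fun n : ℕ => 1 - a * q ^ (n + N) := by
    refine (qP_mult (a * q ^ N) h0 h1).congr fun n => ?_
    rw [pow_add]; ring
  have h2 : qPoch (a * q ^ N) q = ∏' n : ℕ, (1 - a * q ^ (n + N)) := by
    rw [qPoch]
    refine tprod_congr fun n => ?_
    rw [pow_add]; ring
  rw [h2]
  exact (Multipliable.prod_mul_tprod_nat_mul' (f := fun n : ℕ => 1 - a * q ^ n) h).symm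

lemma qP_term_pos {a q : ℝ} (h0 : 0 < q) (h1 : q < 1) (ha : |a| < 1) (n : ℕ) : 0 < 1 - a * q ^ n := by
  have h3 : 0 < q ^ n := by positivity
  have h2 : q ^ n ≤ 1 := pow_le_one₀ h0.le h1.le
  have := (abs_lt.1 ha)
  nlinarith

lemma qP_pos {a q : ℝ} (h0 : 0 < q) (h1 : q < 1) (ha : |a| < 1) : 0 < qPoch a q := by
  have hs : Summable fun n : ℕ => Real.log (1 - a * q ^ n) := by
    simpa [sub_eq_add_neg] using Real.summable_log_one_add_of_summable (qP_summ a h0 h1)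
  rw [qPoch, ← Real.rexp_tsum_eq_tprod (qP_term_pos h0 h1 ha) hs]
  exact Real.exp_pos _

noncomputable def qp (q : ℝ) (N : ℕ) : ℝ := ∏ j ∈ Finset.range N, (1 - q * q ^ j)
noncomputable def qg (q : ℝ) (n : ℤ) : ℝ := if 0 ≤ n then 1 / qp q n.toNat else 0

lemma qp_succ (q : ℝ) (N : ℕ) : qp q (N + 1) = qp q N * (1 - q ^ (N + 1)) := by
  rw [qp, Finset.prod_range_succ, qp, pow_succ']

lemma qp_pos {q : ℝ} (h0 : 0 < q) (h1 : q < 1) (N : ℕ) : 0 < qp q N :=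
  Finset.prod_pos fun j _ => qP_term_pos h0 h1 (by rwa [abs_of_pos h0]) j

lemma qp_anti {q : ℝ} (h0 : 0 < q) (h1 : q < 1) : Antitone (qp q) := by
  refine antitone_nat_of_succ_le fun N => ?_
  rw [qp_succ]
  have : 0 < q ^ (N + 1) := by positivity
  nlinarith [qp_pos h0 h1 N]

lemma qp_ge {q : ℝ} (h0 : 0 < q) (h1 : q < 1) (N : ℕ) : qPoch q q ≤ qp q N :=
  (qp_anti h0 h1).le_of_tendsto (qP_tendsto q h0 h1) N

lemma qp_le {q : ℝ} (h0 : 0 < q) (h1 : q < 1) (N : ℕ) : qp q N ≤ 1 := by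
  have := qp_anti h0 h1 (Nat.zero_le N)
  simpa [qp] using this

lemma qg_rec {q : ℝ} (h0 : 0 < q) (h1 : q < 1) (n : ℤ) : qg q (n - 1) = (1 - q ^ n) * qg q n := by
  rcases lt_trichotomy n 0 with h | h | h
  · rw [qg, qg, if_neg (by omega), if_neg (by omega), mul_zero]
  · subst h; simp [qg]
  · obtain ⟨m, rfl⟩ : ∃ m : ℕ, n = (m : ℤ) + 1 := ⟨(n - 1).toNat, by omega⟩
    rw [qg, qg, if_pos (by omega), if_pos (by omega), show ((m : ℤ) + 1 - 1).toNat = m by omega,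
      show ((m : ℤ) + 1).toNat = m + 1 by omega, qp_succ, show q ^ ((m : ℤ) + 1) = q ^ (m + 1) by
        exact_mod_cast zpow_natCast q (m + 1)]
    have h2 := qp_pos h0 h1 m
    have h3 : 0 < 1 - q ^ (m + 1) := by
      have : q ^ (m + 1) < 1 := pow_lt_one₀ h0.le h1 (by omega)
      linarith
    field_simp

lemma qg_nonneg {q : ℝ} (h0 : 0 < q) (h1 : q < 1) (n : ℤ) : 0 ≤ qg q n := by
  rw [qg]; split_ifs
  · exact (one_div_pos.2 (qp_pos h0 h1 _)).le
  · rfl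

lemma qP_self_pos {q : ℝ} (h0 : 0 < q) (h1 : q < 1) : 0 < qPoch q q :=
  qP_pos h0 h1 (by rwa [abs_of_pos h0])

lemma qg_le {q : ℝ} (h0 : 0 < q) (h1 : q < 1) (n : ℤ) : qg q n ≤ 1 / qPoch q q := by
  rw [qg]; split_ifs
  · exact one_div_le_one_div_of_le (qP_self_pos h0 h1) (qp_ge h0 h1 _)
  · exact (one_div_pos.2 (qP_self_pos h0 h1)).le

lemma qg_tendsto {q : ℝ} (h0 : 0 < q) (h1 : q < 1) (k : ℤ) :
    Filter.Tendsto (fun N : ℕ => qg q (N + k)) Filter.atTop (nhds (1 / qPoch q q)) := by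
  have h2 : Filter.Tendsto (fun N : ℕ => ((N : ℤ) + k).toNat) Filter.atTop Filter.atTop := by
    rw [Filter.tendsto_atTop]
    intro b
    filter_upwards [Filter.eventually_ge_atTop (b + k.natAbs)] with N hN
    omega
  have h3 := (tendsto_const_nhds (x := (1 : ℝ))).div ((qP_tendsto q h0 h1).comp h2) (qP_self_pos h0 h1).ne'
  refine h3.congr' ?_
  filter_upwards [Filter.eventually_ge_atTop k.natAbs] with N hN
  rw [qg, if_pos (by omega)]
  rfl

noncomputable def cf (q : ℝ) (N : ℕ) (k : ℤ) : ℝ := qp q (2 * N) * qg q (N - k) * qg q (N + k)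

lemma cf_rec {q : ℝ} (h0 : 0 < q) (h1 : q < 1) (N : ℕ) (k : ℤ) :
    cf q (N + 1) k = (1 + q ^ (2 * N + 1)) * cf q N k + q ^ ((N : ℤ) + 1 - k) * cf q N (k - 1)
      + q ^ ((N : ℤ) + 1 + k) * cf q N (k + 1) := by
  have hq := h0.ne'
  have a1 := qg_rec h0 h1 ((N : ℤ) + 1 - k)
  have a2 := qg_rec h0 h1 ((N : ℤ) + 1 + k)
  have a3 := qg_rec h0 h1 ((N : ℤ) - k)
  have a4 := qg_rec h0 h1 ((N : ℤ) + k)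
  rw [show (N : ℤ) + 1 - k - 1 = N - k by ring] at a1
  rw [show (N : ℤ) + 1 + k - 1 = N + k by ring] at a2
  set u := q ^ ((N : ℤ) + 1 - k) with hu
  set v := q ^ ((N : ℤ) + 1 + k) with hv
  have b1 : q ^ ((N : ℤ) - k) = u / q := by
    rw [hu, div_eq_mul_inv, ← zpow_sub_one₀ hq]; congr 1; ring
  have b2 : q ^ ((N : ℤ) + k) = v / q := by
    rw [hv, div_eq_mul_inv, ← zpow_sub_one₀ hq]; congr 1; ring
  have b3 : q ^ (2 * N + 2) = u * v := by
    rw [hu, hv, ← zpow_add₀ hq, ← zpow_natCast]; congr 1; push_cast; ring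
  have b4 : q ^ (2 * N + 1) = u * v / q := by
    rw [← b3, eq_div_iff hq]; ring
  rw [cf, cf, cf, cf]
  rw [show (N : ℤ) - (k - 1) = N + 1 - k by ring, show (N : ℤ) + (k - 1) = N + k - 1 by ring,
    show (N : ℤ) - (k + 1) = N - k - 1 by ring, show (N : ℤ) + (k + 1) = N + 1 + k by ring]
  push_cast
  rw [a4, a3, a1, a2, b1, b2, show 2 * (N + 1) = 2 * N + 1 + 1 by ring, qp_succ, qp_succ, b3, b4]
  field_simp
  ring

lemma finJac {y : ℝ} (h0 : 0 < y) (h1 : y < 1) {z : ℝ} (hz : z ≠ 0) (N : ℕ) :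
    HasSum (fun k : ℤ => cf (y ^ 2) N k * y ^ (k ^ 2) * z ^ k)
      (∏ j ∈ Finset.range N, ((1 + y ^ (2 * j + 1) * z) * (1 + y ^ (2 * j + 1) * z⁻¹))) := by
  have hy := h0.ne'
  have hq0 : 0 < y ^ 2 := by positivity
  have hq1 : y ^ 2 < 1 := pow_lt_one₀ h0.le h1 (by norm_num)
  induction N with
  | zero =>
    simp only [Finset.range_zero, Finset.prod_empty]
    have : ∀ k : ℤ, k ≠ 0 → cf (y ^ 2) 0 k * y ^ (k ^ 2) * z ^ k = 0 := by
      intro k hk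
      rcases lt_or_gt_of_ne hk with h | h
      · rw [cf, qg, qg, if_neg (show ¬ (0 ≤ ((0:ℕ):ℤ) + k) by simpa using h)]; simp
      · rw [cf, qg, if_neg (show ¬ (0 ≤ ((0:ℕ):ℤ) - k) by simpa using h)]; simp
    have h2 := hasSum_single (0 : ℤ) this
    simpa [cf, qg, qp] using h2
  | succ N ih =>
    rw [Finset.prod_range_succ]
    have i1 := ih.mul_left (1 + (y ^ 2) ^ (2 * N + 1))
    have i2 := ((Equiv.subRight (1 : ℤ)).hasSum_iff.2 ih).mul_left (y ^ (2 * N + 1) * z)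
    have i3 := ((Equiv.addRight (1 : ℤ)).hasSum_iff.2 ih).mul_left (y ^ (2 * N + 1) * z⁻¹)
    have i4 := (i1.add i2).add i3
    convert! i4 using 1
    · ext k
      simp only [Function.comp, Equiv.subRight_apply, Equiv.coe_addRight]
      rw [cf_rec hq0 hq1]
      have e1 : (y ^ 2) ^ ((N : ℤ) + 1 - k) * y ^ (k ^ 2) = y ^ (2 * N + 1) * y ^ ((k - 1) ^ 2) := by
        rw [← zpow_natCast y 2, ← zpow_mul, ← zpow_natCast y, ← zpow_add₀ hy, ← zpow_add₀ hy]
        congr 1; push_cast; ring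
      have e2 : (y ^ 2) ^ ((N : ℤ) + 1 + k) * y ^ (k ^ 2) = y ^ (2 * N + 1) * y ^ ((k + 1) ^ 2) := by
        rw [← zpow_natCast y 2, ← zpow_mul, ← zpow_natCast y, ← zpow_add₀ hy, ← zpow_add₀ hy]
        congr 1; push_cast; ring
      have e3 : z * z ^ (k - 1) = z ^ k := by
        rw [zpow_sub_one₀ hz]; field_simp
      have e4 : z⁻¹ * z ^ (k + 1) = z ^ k := by
        rw [zpow_add_one₀ hz]; field_simp
      linear_combination (cf (y ^ 2) N (k - 1) * z ^ k) * e1 + (cf (y ^ 2) N (k + 1) * z ^ k) * e2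
        - (y ^ (2 * N + 1) * cf (y ^ 2) N (k - 1) * y ^ ((k - 1) ^ 2)) * e3
        - (y ^ (2 * N + 1) * cf (y ^ 2) N (k + 1) * y ^ ((k + 1) ^ 2)) * e4
    · generalize ∏ j ∈ Finset.range N, ((1 + y ^ (2 * j + 1) * z) * (1 + y ^ (2 * j + 1) * z⁻¹)) = P
      have e5 : (y ^ 2) ^ (2 * N + 1) = (y ^ (2 * N + 1)) ^ 2 := by ring
      rw [e5]
      linear_combination (P * (y ^ (2 * N + 1)) ^ 2) * (mul_inv_cancel₀ hz)

lemma jac {y : ℝ} (h0 : 0 < y) (h1 : y < 1) {z : ℝ} (hz : z = 1 ∨ z = -1)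
    (hs : Summable fun k : ℤ => y ^ (k ^ 2)) :
    qPoch (-z * y) (y ^ 2) ^ 2 = 1 / qPoch (y ^ 2) (y ^ 2) * ∑' k : ℤ, y ^ (k ^ 2) * z ^ k := by
  have hq0 : 0 < y ^ 2 := by positivity
  have hq1 : y ^ 2 < 1 := pow_lt_one₀ h0.le h1 (by norm_num)
  have hzi : z⁻¹ = z := by rcases hz with h | h <;> rw [h] <;> norm_num
  have hz0 : z ≠ 0 := by rcases hz with h | h <;> rw [h] <;> norm_num
  have hza : ∀ k : ℤ, |z ^ k| = 1 := by
    intro k; rcases hz with h | h <;> rw [h] <;> simp [abs_zpow]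
  set C := 1 / qPoch (y ^ 2) (y ^ 2) with hC
  have hCp : 0 < C := one_div_pos.2 (qP_self_pos hq0 hq1)
  have t1 := (qP_tendsto (-z * y) hq0 hq1).pow 2
  have t2 : Filter.Tendsto (fun N : ℕ => ∑' k : ℤ, cf (y ^ 2) N k * y ^ (k ^ 2) * z ^ k) Filter.atTop
      (nhds (∑' k : ℤ, C * (y ^ (k ^ 2) * z ^ k))) := by
    refine tendsto_tsum_of_dominated_convergence (hs.mul_left (C * C)) (fun k => ?_)
      (.of_forall fun N k => ?_)
    · have l1 := qg_tendsto hq0 hq1 k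
      have l2 := qg_tendsto hq0 hq1 (-k)
      have l3 : Filter.Tendsto (fun N : ℕ => qp (y ^ 2) (2 * N)) Filter.atTop (nhds (qPoch (y ^ 2) (y ^ 2))) :=
        (qP_tendsto (y ^ 2) hq0 hq1).comp (Filter.tendsto_id.const_mul_atTop' (by norm_num))
      have l4 := (((l3.mul l2).mul l1).mul_const (y ^ (k ^ 2))).mul_const (z ^ k)
      have := (qP_self_pos hq0 hq1).ne'
      rw [mul_one_div_cancel this, one_mul, mul_assoc] at l4
      exact l4
    · rw [norm_mul, norm_mul, Real.norm_eq_abs (z ^ k), hza, mul_one, Real.norm_eq_abs, Real.norm_eq_abs,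
        abs_of_pos (zpow_pos h0 _)]
      refine mul_le_mul_of_nonneg_right ?_ (zpow_pos h0 _).le
      have g1 := qg_nonneg hq0 hq1 (N - k)
      have g2 := qg_nonneg hq0 hq1 (N + k)
      have g3 := (qp_pos hq0 hq1 (2 * N)).le
      rw [cf, abs_of_nonneg (by positivity)]
      refine mul_le_mul ?_ (qg_le hq0 hq1 _) g2 hCp.le
      calc _ ≤ 1 * qg (y ^ 2) (N - k) := mul_le_mul_of_nonneg_right (qp_le hq0 hq1 _) g1
        _ ≤ C := by rw [one_mul]; exact qg_le hq0 hq1 _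
  rw [tsum_mul_left] at t2
  refine tendsto_nhds_unique t1 (t2.congr fun N => ?_)
  rw [(finJac h0 h1 hz0 N).tsum_eq, ← Finset.prod_pow]
  refine Finset.prod_congr rfl fun j _ => ?_
  rw [hzi, pow_succ, pow_mul]
  ring


lemma ell_theta {s : ℝ} (hs : 0 < s) : ellI (th3 s ^ 2) (th4 s ^ 2) = Real.pi / 2 := by
  have step : ∀ s : ℝ, 0 < s → ellI (th3 (2 * s) ^ 2) (th4 (2 * s) ^ 2) = ellI (th3 s ^ 2) (th4 s ^ 2) := by
    intro s hs
    have h3 := th3_pos hs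
    have h4 := th4_pos hs
    rw [← ell_gauss (a := th3 s ^ 2) (b := th4 s ^ 2) (by positivity) (by positivity)]
    congr 1
    · rw [th3_sq hs, th4_sq hs]; ring
    · rw [← mul_pow, Real.sqrt_sq (by positivity), th34 hs]
  have hall : ∀ m : ℕ, ellI (th3 (2 ^ m * s) ^ 2) (th4 (2 ^ m * s) ^ 2) = ellI (th3 s ^ 2) (th4 s ^ 2) := by
    intro m
    induction m with
    | zero => simp
    | succ m ih =>
      rw [← ih, ← step (2 ^ m * s) (by positivity)]
      congr 3 <;> ring
  have hp : ∀ m : ℕ, 0 < 2 ^ m * s := fun m => by positivity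
  have := ell_tendsto (u := fun m => th3 (2 ^ m * s) ^ 2) (v := fun m => th4 (2 ^ m * s) ^ 2)
    (fun m => pow_pos (th3_pos (hp m)) 2) (fun m => pow_pos (th4_pos (hp m)) 2)
    (by simpa using (th3_lim hs).pow 2) (by simpa using (th4_lim hs).pow 2)
  simp_rw [hall] at this
  exact tendsto_nhds_unique tendsto_const_nhds this

lemma Kint_eq {k k' : ℝ} (h : k ^ 2 + k' ^ 2 = 1) : Kint k = ellI 1 k' := by
  rw [Kint, ellI]
  congr 1; ext t
  have h1 := Real.sin_sq_add_cos_sq t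
  congr 2
  rw [show k ^ 2 = 1 - k' ^ 2 by linarith, show Real.cos t ^ 2 = 1 - Real.sin t ^ 2 by linarith]
  ring

lemma Kint_cont {k : ℝ} (h0 : 0 ≤ k) (h1 : k < 1) (t : ℝ) :
    0 < 1 - k ^ 2 * Real.sin t ^ 2 := by
  have := Real.sin_sq_le_one t
  have : k ^ 2 < 1 := pow_lt_one₀ h0 h1 (by norm_num)
  nlinarith [sq_nonneg (Real.sin t), sq_nonneg k]

lemma Kint_contin {k : ℝ} (h0 : 0 ≤ k) (h1 : k < 1) :
    Continuous fun t => 1 / Real.sqrt (1 - k ^ 2 * Real.sin t ^ 2) :=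
  continuous_const.div (by fun_prop) fun t => (Real.sqrt_pos.2 (Kint_cont h0 h1 t)).ne'

lemma Kint_lt {k l : ℝ} (h0 : 0 ≤ k) (hkl : k < l) (h1 : l < 1) : Kint k < Kint l := by
  have hk1 : k < 1 := hkl.trans h1
  have hl0 : 0 ≤ l := h0.trans hkl.le
  have hsq : k ^ 2 < l ^ 2 := pow_lt_pow_left₀ hkl h0 (by norm_num)
  refine intervalIntegral.integral_lt_integral_of_continuousOn_of_le_of_exists_lt (by positivity)
    (Kint_contin h0 hk1).continuousOn (Kint_contin hl0 h1).continuousOn (fun t _ => ?_)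
    ⟨Real.pi / 2, ⟨by positivity, le_rfl⟩, ?_⟩
  · refine one_div_le_one_div_of_le (Real.sqrt_pos.2 (Kint_cont hl0 h1 t)) (Real.sqrt_le_sqrt ?_)
    nlinarith [sq_nonneg (Real.sin t)]
  · refine one_div_lt_one_div_of_lt (Real.sqrt_pos.2 (Kint_cont hl0 h1 _)) (Real.sqrt_lt_sqrt ?_ ?_)
    · exact (Kint_cont hl0 h1 _).le
    · simpa using hsq

lemma uniq {k l c : ℝ} (hc : 0 < c) (hk0 : 0 < k) (_hk1 : k < 1) (hl0 : 0 < l) (hl1 : l < 1)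
    (hk : Kint (Real.sqrt (1 - k ^ 2)) = c * Kint k)
    (hl : Kint (Real.sqrt (1 - l ^ 2)) = c * Kint l) : ¬ k < l := by
  intro h
  have h1 := mul_lt_mul_of_pos_left (Kint_lt hk0.le h hl1) hc
  have hsq : k ^ 2 < l ^ 2 := pow_lt_pow_left₀ h hk0.le (by norm_num)
  have hl2 : l ^ 2 < 1 := pow_lt_one₀ hl0.le hl1 (by norm_num)
  have h2 : Kint (Real.sqrt (1 - l ^ 2)) < Kint (Real.sqrt (1 - k ^ 2)) := by
    refine Kint_lt (Real.sqrt_nonneg _) (Real.sqrt_lt_sqrt (by linarith) (by linarith)) ?_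
    rw [Real.sqrt_lt' one_pos]
    have : 0 < k ^ 2 := by positivity
    linarith
  linarith

lemma jacobi_id {s : ℝ} (hs : 0 < s) : th3 s ^ 4 = th2 s ^ 4 + th4 s ^ 4 := by
  have hs2 : 0 < s / 2 := by positivity
  have h1 := th3_sq hs2
  have h2 := th4_sq hs2
  have h3 := th34 hs2
  rw [show 2 * (s / 2) = s by ring] at h1 h2 h3
  have : (th3 (s / 2) * th4 (s / 2)) ^ 2 = (th3 s ^ 2 + th2 s ^ 2) * (th3 s ^ 2 - th2 s ^ 2) := by
    rw [← h1, ← h2]; ring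
  rw [h3] at this
  linear_combination -this

lemma K_theta {s : ℝ} (hs : 0 < s) :
    0 < th2 s ^ 2 / th3 s ^ 2 ∧ th2 s ^ 2 / th3 s ^ 2 < 1 ∧
    Kint (Real.sqrt (1 - (th2 s ^ 2 / th3 s ^ 2) ^ 2)) = s * Kint (th2 s ^ 2 / th3 s ^ 2) := by
  have p2 := th2_pos hs
  have p3 := th3_pos hs
  have p4 := th4_pos hs
  have hJ := jacobi_id hs
  have hlt : th2 s ^ 2 < th3 s ^ 2 := by
    refine lt_of_pow_lt_pow_left₀ 2 (by positivity) ?_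
    have : 0 < th4 s ^ 4 := by positivity
    nlinarith
  refine ⟨by positivity, by rwa [div_lt_one (by positivity)], ?_⟩
  have e1 : (th2 s ^ 2 / th3 s ^ 2) ^ 2 + (th4 s ^ 2 / th3 s ^ 2) ^ 2 = 1 := by
    field_simp; linarith
  have hk' : Real.sqrt (1 - (th2 s ^ 2 / th3 s ^ 2) ^ 2) = th4 s ^ 2 / th3 s ^ 2 := by
    rw [show 1 - (th2 s ^ 2 / th3 s ^ 2) ^ 2 = (th4 s ^ 2 / th3 s ^ 2) ^ 2 by linarith]
    exact Real.sqrt_sq (by positivity)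
  have hinv : 0 < 1 / s := by positivity
  rw [hk', Kint_eq e1, Kint_eq (k := th4 s ^ 2 / th3 s ^ 2) (by rw [add_comm]; exact e1)]
  have a1 := ell_theta hs
  have a2 := ell_theta hinv
  have b1 := ell_scale (a := 1) (b := th4 s ^ 2 / th3 s ^ 2) (c := th3 s ^ 2) (by positivity)
  have b2 := ell_scale (a := 1) (b := th2 s ^ 2 / th3 s ^ 2) (c := s * th3 s ^ 2) (by positivity)
  rw [mul_one, mul_div_cancel₀ _ (by positivity), a1] at b1
  rw [mul_one, mul_assoc, mul_div_cancel₀ _ (by positivity), ← th4_inv hs,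
    show s * th3 s ^ 2 = th3 (1 / s) ^ 2 by rw [th3_inv hs]; field_simp, a2,
    show th3 (1 / s) ^ 2 = s * th3 s ^ 2 by rw [th3_inv hs]; field_simp] at b2
  rw [eq_div_iff (by positivity)] at b1 b2
  rw [← b1, ← b2]; ring

lemma y_zpow (s : ℝ) (k : ℤ) : Real.exp (-Real.pi * s) ^ (k ^ 2) = Real.exp (-Real.pi * s * (k : ℝ) ^ 2) := by
  rw [← Real.rpow_intCast, ← Real.exp_mul]
  congr 1; push_cast; ring

lemma prod_theta {s : ℝ} (hs : 0 < s) {y q : ℝ} (hy : y = Real.exp (-Real.pi * s)) (hq : q = y ^ 2) :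
    (qPoch (-y) q / qPoch y q) ^ 2 = th3 s / th4 s := by
  have h0 : 0 < y := hy ▸ Real.exp_pos _
  have h1 : y < 1 := by
    rw [hy, Real.exp_lt_one_iff]
    have := mul_pos Real.pi_pos hs
    linarith
  have hq0 : 0 < q := by rw [hq]; positivity
  have hq1 : q < 1 := by rw [hq]; exact pow_lt_one₀ h0.le h1 (by norm_num)
  have hsum : Summable fun k : ℤ => y ^ (k ^ 2) := by
    simp_rw [hy, y_zpow]; exact summ3 hs
  have j1 := jac h0 h1 (z := 1) (Or.inl rfl) hsum
  have j2 := jac h0 h1 (z := -1) (Or.inr rfl) hsum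
  rw [← hq] at j1 j2
  have e3 : ∑' k : ℤ, y ^ (k ^ 2) * (1 : ℝ) ^ k = th3 s := by
    simp_rw [hy, y_zpow, one_zpow, mul_one]; rfl
  have e4 : ∑' k : ℤ, y ^ (k ^ 2) * (-1 : ℝ) ^ k = th4 s := by
    exact tsum_congr fun k => by rw [hy, y_zpow, mul_comm]
  rw [e3, neg_one_mul] at j1
  rw [e4, neg_neg, one_mul] at j2
  have := qP_self_pos hq0 hq1
  have := th4_pos hs
  rw [div_pow, j1, j2]
  field_simp

/-- For `q = e^{-π√r}` and every positive integer `ν`,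
`k_r = tanh(4 ∑_{j=0}^{ν-1} arctanh(q^{j+1/2}) + log(((-q^{ν+1/2};q)_∞/(q^{ν+1/2};q)_∞)²))`. -/
theorem stmt_17 (r : ℝ) (hr : 0 < r) (q : ℝ) (hq : q = Real.exp (-Real.pi * Real.sqrt r))
    (k : ℝ) (hk0 : 0 < k) (hk1 : k < 1)
    (hK : Kint (Real.sqrt (1 - k ^ 2)) = Real.sqrt r * Kint k) (ν : ℕ) (hν : 1 ≤ ν) :
    k = Real.tanh (4 * (∑ j ∈ Finset.range ν, arctanh (q ^ ((j : ℝ) + 1 / 2))) +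
      Real.log ((qPoch (-(q ^ ((ν : ℝ) + 1 / 2))) q / qPoch (q ^ ((ν : ℝ) + 1 / 2)) q) ^ 2)) := by
  have hs : 0 < Real.sqrt r := Real.sqrt_pos.2 hr
  set s := Real.sqrt r with hsdef
  have hs2 : 0 < s / 2 := by positivity
  obtain ⟨y, hy⟩ : ∃ y, y = Real.exp (-Real.pi * (s / 2)) := ⟨_, rfl⟩
  have hqy : q = y ^ 2 := by
    rw [hq, hy, ← Real.exp_nat_mul]; congr 1; push_cast; ring
  have h0 : 0 < y := hy ▸ Real.exp_pos _
  have h1 : y < 1 := by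
    rw [hy, Real.exp_lt_one_iff]
    have := mul_pos Real.pi_pos hs2
    linarith
  have hq0 : 0 < q := by rw [hqy]; positivity
  have hq1 : q < 1 := by rw [hqy]; exact pow_lt_one₀ h0.le h1 (by norm_num)
  have hpow : ∀ j : ℕ, q ^ ((j : ℝ) + 1 / 2) = y * q ^ j := by
    intro j
    rw [Real.rpow_add hq0, Real.rpow_natCast, ← Real.sqrt_eq_rpow, hqy, Real.sqrt_sq h0.le, mul_comm]
  have hya : |y| < 1 := by rwa [abs_of_pos h0]
  have hyb : |-y| < 1 := by rwa [abs_neg]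
  have hyν : |y * q ^ ν| < 1 := by
    rw [abs_of_pos (by positivity)]
    have : q ^ ν ≤ 1 := pow_le_one₀ hq0.le hq1.le
    nlinarith
  have pA := qP_pos hq0 hq1 hyb
  have pB := qP_pos hq0 hq1 hya
  have pA' : 0 < qPoch (-(y * q ^ ν)) q := qP_pos hq0 hq1 (by rwa [abs_neg])
  have pB' : 0 < qPoch (y * q ^ ν) q := qP_pos hq0 hq1 hyν
  have tp : ∀ j : ℕ, 0 < 1 + y * q ^ j := fun j => by positivity
  have tm : ∀ j : ℕ, 0 < 1 - y * q ^ j := qP_term_pos hq0 hq1 hya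
  have harg : 4 * (∑ j ∈ Finset.range ν, arctanh (q ^ ((j : ℝ) + 1 / 2))) +
      Real.log ((qPoch (-(q ^ ((ν : ℝ) + 1 / 2))) q / qPoch (q ^ ((ν : ℝ) + 1 / 2)) q) ^ 2)
      = Real.log ((qPoch (-y) q / qPoch y q) ^ 2) := by
    simp_rw [hpow, arctanh]
    rw [← Finset.sum_div, ← Real.log_prod (fun j _ => (div_pos (tp j) (tm j)).ne'), Finset.prod_div_distrib]
    rw [qP_split (-y) hq0 hq1 ν, qP_split y hq0 hq1 ν, neg_mul]
    have n1 : 0 < ∏ j ∈ Finset.range ν, (1 + y * q ^ j) := Finset.prod_pos fun j _ => tp j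
    have n2 : 0 < ∏ j ∈ Finset.range ν, (1 - y * q ^ j) := Finset.prod_pos fun j _ => tm j
    have n3 : ∏ j ∈ Finset.range ν, (1 - -y * q ^ j) = ∏ j ∈ Finset.range ν, (1 + y * q ^ j) :=
      Finset.prod_congr rfl fun j _ => by ring
    rw [n3, mul_div_mul_comm, mul_pow, Real.log_mul (by positivity) (by positivity), Real.log_pow, Real.log_pow]
    push_cast
    ring
  rw [harg, prod_theta hs2 hy hqy]
  have p3 := th3_pos hs2
  have p4 := th4_pos hs2
  have q3 := th3_pos hs
  have hX : 0 < th3 (s / 2) / th4 (s / 2) := by positivity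
  have htanh : Real.tanh (Real.log (th3 (s / 2) / th4 (s / 2))) = th2 s ^ 2 / th3 s ^ 2 := by
    rw [Real.tanh_eq_sinh_div_cosh, Real.sinh_log hX, Real.cosh_log hX]
    have h1 := th3_sq hs2
    have h2 := th4_sq hs2
    rw [show 2 * (s / 2) = s by ring] at h1 h2
    have e2 : th2 s ^ 2 = (th3 (s / 2) ^ 2 - th4 (s / 2) ^ 2) / 2 := by linarith
    have e3 : th3 s ^ 2 = (th3 (s / 2) ^ 2 + th4 (s / 2) ^ 2) / 2 := by linarith
    rw [e2, e3]
    field_simp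
  rw [htanh]
  obtain ⟨l0, l1, hl⟩ := K_theta hs
  exact le_antisymm (not_lt.1 (uniq hs l0 l1 hk0 hk1 hl hK)) (not_lt.1 (uniq hs hk0 hk1 l0 l1 hK hl))
end

section
/- Let r > 0, set q = e^{−π√r}, assume k_r ∈ (0,1) satisfies K(√(1 − k_r²)) = √r · K(k_r), and let k'_r = √(1 − k_r²). Then the continued fraction u(q,q) converges, u(q,q) ≠ 1, and −1 + 2/(1 − u(q,q)) = π/(2·k'_r·K(k_r)). -/
open Filter

/-- Numerator pairs `(p_{n-1}, p_n)` of the continued fraction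
`c 1 / (b 1 + c 2 / (b 2 + ⋯))` (indices start at 1). -/
noncomputable def cfNum (c b : ℕ → ℝ) : ℕ → ℝ × ℝ
  | 0 => (1, 0)
  | n + 1 => ((cfNum c b n).2, b (n + 1) * (cfNum c b n).2 + c (n + 1) * (cfNum c b n).1)

/-- Denominator pairs `(q_{n-1}, q_n)` of the continued fraction. -/
noncomputable def cfDen (c b : ℕ → ℝ) : ℕ → ℝ × ℝ
  | 0 => (0, 1)
  | n + 1 => ((cfDen c b n).2, b (n + 1) * (cfDen c b n).2 + c (n + 1) * (cfDen c b n).1)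

/-- The continued fraction with partial numerators `c` and partial denominators `b`
(both indexed from 1) converges to `L`, i.e. its convergents tend to `L`. -/
def CFTendsto (c b : ℕ → ℝ) (L : ℝ) : Prop :=
  Tendsto (fun n => (cfNum c b n).2 / (cfDen c b n).2) atTop (nhds L)
open Filter Topology

/-- q-Pochhammer -/
noncomputable def pq (q : ℝ) (n : ℕ) : ℝ := ∏ i ∈ Finset.range n, (1 - q ^ (i + 1))
noncomputable def mq (q : ℝ) (n : ℕ) : ℝ := ∏ i ∈ Finset.range n, (1 + q ^ (i + 1))

lemma pq_pos {q : ℝ} (h0 : 0 < q) (h1 : q < 1) (n : ℕ) : 0 < pq q n :=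
  Finset.prod_pos fun i _ => sub_pos.2 (pow_lt_one₀ h0.le h1 (Nat.succ_ne_zero i))

lemma mq_pos {q : ℝ} (h0 : 0 < q) (n : ℕ) : 0 < mq q n :=
  Finset.prod_pos fun i _ => by positivity

lemma one_le_mq {q : ℝ} (h0 : 0 < q) (n : ℕ) : 1 ≤ mq q n := by
  induction n with
  | zero => simp [mq]
  | succ n ih =>
    rw [mq, Finset.prod_range_succ, ← mq]
    have : 0 < q ^ (n+1) := by positivity
    nlinarith

/-- coefficients of F -/
noncomputable def hq (q : ℝ) (n : ℕ) : ℝ := ∏ i ∈ Finset.range n, ((1 + q ^ i) / (1 - q ^ (i + 1)))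

lemma hq_succ {q : ℝ} (h0 : 0 < q) (h1 : q < 1) (n : ℕ) :
    hq q (n+1) * (1 - q ^ (n + 1)) = hq q n * (1 + q ^ n) := by
  have : 0 < 1 - q ^ (n+1) := sub_pos.2 (pow_lt_one₀ h0.le h1 (Nat.succ_ne_zero n))
  rw [hq, Finset.prod_range_succ, ← hq]
  field_simp

lemma hq_pos {q : ℝ} (h0 : 0 < q) (h1 : q < 1) (n : ℕ) : 0 < hq q n :=
  Finset.prod_pos fun i _ => by
    have : 0 < 1 - q ^ (i+1) := sub_pos.2 (pow_lt_one₀ h0.le h1 (Nat.succ_ne_zero i))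
    positivity

lemma hq_summable {q : ℝ} (h0 : 0 < q) (h1 : q < 1) (a : ℝ) (ha : |a| < 1) :
    Summable (fun n => hq q n * a ^ n) := by
  rcases eq_or_ne a 0 with rfl | ha0
  · apply summable_of_ne_finset_zero (s := {0})
    intro b hb
    simp at hb
    simp [hb]
  have hp : Tendsto (fun n : ℕ => q ^ n) atTop (𝓝 0) :=
    tendsto_pow_atTop_nhds_zero_of_lt_one h0.le h1
  have hp1 : Tendsto (fun n : ℕ => q ^ (n+1)) atTop (𝓝 0) := (tendsto_add_atTop_iff_nat 1).2 hp
  apply summable_of_ratio_test_tendsto_lt_one ha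
  · exact Eventually.of_forall fun n => mul_ne_zero (hq_pos h0 h1 n).ne' (pow_ne_zero _ ha0)
  · have : Tendsto (fun n : ℕ => (1 + q ^ n) / (1 - q ^ (n+1)) * |a|) atTop (𝓝 ((1+0)/(1-0) * |a|)) := by
      apply Tendsto.mul_const
      apply Tendsto.div (hp.const_add 1) (hp1.const_sub 1); norm_num
    simp only [add_zero, sub_zero, div_one, one_mul] at this
    refine this.congr fun n => ?_
    have h2 : 0 < 1 - q ^ (n+1) := sub_pos.2 (pow_lt_one₀ h0.le h1 (Nat.succ_ne_zero n))
    have h3 := hq_succ h0 h1 n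
    have h4 := hq_pos h0 h1 n
    have h5 := hq_pos h0 h1 (n+1)
    rw [norm_mul, norm_mul, norm_pow, norm_pow, Real.norm_of_nonneg h4.le, Real.norm_of_nonneg h5.le,
      Real.norm_eq_abs]
    have h6 : 0 < |a| := abs_pos.2 ha0
    rw [eq_div_iff (by positivity), pow_succ |a| n]
    rw [div_mul_eq_mul_div, div_mul_eq_mul_div, div_eq_iff h2.ne']
    linear_combination -(|a| * |a|^n) * h3

noncomputable def Fq (q a : ℝ) : ℝ := ∑' n, hq q n * a ^ n

lemma Fq_eq {q : ℝ} (h0 : 0 < q) (h1 : q < 1) (a : ℝ) (ha : |a| < 1) :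
    (1 - a) * Fq q a = (1 + a) * Fq q (a * q) := by
  have haq : |a * q| < 1 := by
    rw [abs_mul, abs_of_pos h0]; nlinarith [abs_nonneg a]
  have s1 := hq_summable h0 h1 a ha
  have s2 := hq_summable h0 h1 (a*q) haq
  have e1 : Fq q a - Fq q (a * q) = ∑' n, (hq q n * a ^ n - hq q n * (a*q) ^ n) := by
    rw [s1.tsum_sub s2]; rfl
  have e2 : a * Fq q a + a * Fq q (a * q) = ∑' n, (a * (hq q n * a ^ n) + a * (hq q n * (a*q) ^ n)) := by
    rw [(s1.mul_left a).tsum_add (s2.mul_left a), tsum_mul_left, tsum_mul_left]; rfl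
  have e3 := (s1.sub s2).tsum_eq_zero_add
  have e4 : ∑' n, (hq q (n+1) * a ^ (n+1) - hq q (n+1) * (a*q) ^ (n+1))
      = ∑' n, (a * (hq q n * a ^ n) + a * (hq q n * (a*q) ^ n)) := by
    congr 1; ext n
    have h3 := hq_succ h0 h1 n
    rw [mul_pow, mul_pow]
    linear_combination (a^(n+1)) * h3
  simp at e3
  linarith

lemma Fq_tendsto {q : ℝ} (h0 : 0 < q) (h1 : q < 1) : Tendsto (Fq q) (𝓝 0) (𝓝 1) := by
  have s := hq_summable h0 h1 (1/2) (by rw [abs_of_pos] <;> norm_num)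
  have := tendsto_tsum_of_dominated_convergence (f := fun (a : ℝ) n => hq q n * a ^ n)
    (g := fun n => hq q n * 0 ^ n) (𝓕 := 𝓝 (0:ℝ)) s (fun n => by
      apply Tendsto.const_mul
      exact (continuous_pow n).tendsto _) (by
      have : ∀ᶠ a : ℝ in 𝓝 0, |a| < 1/2 := by
        have := Metric.ball_mem_nhds (0:ℝ) (show (0:ℝ) < 1/2 by norm_num)
        filter_upwards [this] with a ha
        simpa using ha
      filter_upwards [this] with a ha n
      rw [norm_mul, norm_pow, Real.norm_of_nonneg (hq_pos h0 h1 n).le, Real.norm_eq_abs]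
      gcongr
      exact (hq_pos h0 h1 n).le)
  have e : ∑' n, hq q n * 0 ^ n = 1 := by
    rw [tsum_eq_single 0]
    · simp [hq]
    · intro n hn; simp [hn]
  rw [e] at this
  exact this

lemma Fq_iter {q : ℝ} (h0 : 0 < q) (h1 : q < 1) (n : ℕ) :
    pq q n * Fq q q = mq q n * Fq q (q ^ (n+1)) ∧ mq q n * Fq q (-q) = pq q n * Fq q (-q ^ (n+1)) := by
  induction n with
  | zero => simp [pq, mq]
  | succ n ih =>
    have hh : |q^(n+1)| < 1 := by
      rw [abs_of_pos (by positivity)]; exact pow_lt_one₀ h0.le h1 (Nat.succ_ne_zero n)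
    have e1 := Fq_eq h0 h1 (q^(n+1)) hh
    have e2 := Fq_eq h0 h1 (-q^(n+1)) (by rwa [abs_neg])
    rw [← pow_succ] at e1
    rw [neg_mul, ← pow_succ] at e2
    rw [pq, mq, Finset.prod_range_succ, Finset.prod_range_succ, ← pq, ← mq]
    constructor
    · linear_combination (1 - q^(n+1)) * ih.1 + mq q n * e1
    · linear_combination (1 + q^(n+1)) * ih.2 + pq q n * e2

lemma tend_pow {q : ℝ} (h0 : 0 < q) (h1 : q < 1) : Tendsto (fun n : ℕ => q ^ (n+1)) atTop (𝓝 0) :=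
  (tendsto_add_atTop_iff_nat 1).2 (tendsto_pow_atTop_nhds_zero_of_lt_one h0.le h1)

lemma Fq_pos {q : ℝ} (h0 : 0 < q) (h1 : q < 1) : 1 ≤ Fq q q := by
  have := (hq_summable h0 h1 q (by rwa [abs_of_pos h0])).le_tsum 0
    (fun n _ => mul_nonneg (hq_pos h0 h1 n).le (by positivity))
  simpa [hq, Fq] using this

lemma Pi_tendsto {q : ℝ} (h0 : 0 < q) (h1 : q < 1) :
    Tendsto (fun n => pq q n / mq q n) atTop (𝓝 (1 / Fq q q)) := by
  have := ((Fq_tendsto h0 h1).comp (tend_pow h0 h1)).div_const (Fq q q)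
  refine this.congr fun n => ?_
  have := (Fq_iter h0 h1 n).1
  have h2 := mq_pos h0 n
  have h3 := Fq_pos h0 h1
  simp only [Function.comp]
  rw [div_eq_div_iff (by positivity) h2.ne']
  linarith

lemma Fq_neg {q : ℝ} (h0 : 0 < q) (h1 : q < 1) : Fq q (-q) = 1 / Fq q q := by
  have t : Tendsto (fun n : ℕ => - q ^ (n+1)) atTop (𝓝 0) := by simpa using (tend_pow h0 h1).neg
  have := (Pi_tendsto h0 h1).mul ((Fq_tendsto h0 h1).comp t)
  rw [mul_one] at this
  refine tendsto_nhds_unique ?_ this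
  refine tendsto_const_nhds.congr fun n => ?_
  have := (Fq_iter h0 h1 n).2
  have h2 := mq_pos h0 n
  simp only [Function.comp]
  rw [div_mul_eq_mul_div, eq_div_iff h2.ne']
  linarith


/-- reciprocal q-Pochhammer on ℤ -/
noncomputable def iq (q : ℝ) (k : ℤ) : ℝ := if k < 0 then 0 else 1 / pq q k.toNat

lemma iq_rec {q : ℝ} (h0 : 0 < q) (h1 : q < 1) (k : ℤ) : iq q (k - 1) = (1 - q ^ k) * iq q k := by
  rcases lt_trichotomy k 0 with h | h | h
  · rw [iq, iq, if_pos h, if_pos (by omega), mul_zero]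
  · subst h; simp [iq]
  · obtain ⟨n, rfl⟩ : ∃ n : ℕ, k = n + 1 := ⟨(k-1).toNat, by omega⟩
    rw [iq, iq, if_neg (by omega), if_neg (by omega)]
    have e1 : ((n:ℤ) + 1 - 1).toNat = n := by omega
    have e2 : ((n:ℤ) + 1).toNat = n + 1 := by omega
    have e3 : q ^ ((n:ℤ)+1) = q ^ (n+1) := by exact_mod_cast rfl
    rw [e1, e2, e3]
    have h3 := pq_pos h0 h1 n
    have : 0 < 1 - q ^ (n+1) := sub_pos.2 (pow_lt_one₀ h0.le h1 (Nat.succ_ne_zero n))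
    have e4 : pq q (n+1) = pq q n * (1 - q^(n+1)) := by rw [pq, Finset.prod_range_succ, ← pq]
    rw [e4]
    field_simp

lemma iq_nonneg {q : ℝ} (h0 : 0 < q) (h1 : q < 1) (k : ℤ) : 0 ≤ iq q k := by
  rw [iq]; split_ifs
  · rfl
  · exact one_div_nonneg.2 (pq_pos h0 h1 _).le

lemma pq_bound {q : ℝ} (h0 : 0 < q) (h1 : q < 1) : ∃ c : ℝ, 0 < c ∧ (∀ n, c ≤ pq q n) ∧
    Tendsto (pq q) atTop (𝓝 c) := by
  have anti : Antitone (pq q) := by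
    apply antitone_nat_of_succ_le
    intro n
    rw [pq, Finset.prod_range_succ, ← pq]
    have := pq_pos h0 h1 n
    have : 0 < q ^ (n+1) := by positivity
    nlinarith
  have bdd : BddBelow (Set.range (pq q)) := ⟨0, by rintro _ ⟨n, rfl⟩; exact (pq_pos h0 h1 n).le⟩
  have t := tendsto_atTop_ciInf anti bdd
  have h3 := Fq_pos h0 h1
  refine ⟨_, ?_, fun n => ciInf_le bdd n, t⟩
  have : 1 / Fq q q ≤ ⨅ i, pq q i := by
    refine le_of_tendsto_of_tendsto (Pi_tendsto h0 h1) t (Eventually.of_forall fun n => ?_)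
    exact div_le_self (pq_pos h0 h1 n).le (one_le_mq h0 n)
  have h4 : 0 < 1 / Fq q q := by positivity
  linarith

lemma iq_tendsto {q c : ℝ} (hc : 0 < c) (ht : Tendsto (pq q) atTop (𝓝 c)) (r : ℤ) :
    Tendsto (fun n : ℕ => iq q (n + r)) atTop (𝓝 (1 / c)) := by
  have t1 : Tendsto (fun n : ℕ => ((n:ℤ) + r).toNat) atTop atTop := by
    rw [tendsto_atTop_atTop]
    intro b
    exact ⟨b + r.natAbs, fun a ha => by omega⟩
  have := (tendsto_const_nhds (x := (1:ℝ))).div (ht.comp t1) hc.ne'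
  refine this.congr' ?_
  filter_upwards [eventually_ge_atTop r.natAbs] with n hn
  rw [iq, if_neg (by omega)]; rfl

noncomputable def gt (q : ℝ) (n : ℕ) (r : ℤ) : ℝ := (-1) ^ r * q ^ (r ^ 2) * iq q (n - r) * iq q (n + r)

lemma gt_summable (q : ℝ) (n : ℕ) : Summable (gt q n) := by
  apply summable_of_ne_finset_zero (s := Finset.Icc (-(n:ℤ)) n)
  intro r hr
  rw [Finset.mem_Icc, not_and_or] at hr
  rcases hr with h | h
  · rw [gt, iq, iq, if_pos (show (n:ℤ) + r < 0 by omega), mul_zero]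
  · rw [gt, iq, iq, if_pos (show (n:ℤ) - r < 0 by omega), mul_zero, zero_mul]

lemma gt_sum {q : ℝ} (h0 : 0 < q) (h1 : q < 1) (n : ℕ) :
    (∑' r, gt q n r) * (pq q n * mq q n) = 1 := by
  induction n with
  | zero =>
    rw [tsum_eq_single 0]
    · simp [gt, iq, pq, mq]
    · intro r hr
      rcases lt_or_gt_of_ne hr with h | h
      · rw [gt, iq, iq, if_pos (show ((0:ℕ):ℤ) + r < 0 by simpa using h), mul_zero]
      · rw [gt, iq, iq, if_pos (show ((0:ℕ):ℤ) - r < 0 by simpa using h), mul_zero, zero_mul]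
  | succ n ih =>
    set v : ℤ → ℝ := fun r => (-1) ^ r * q ^ (r^2 - r) * q ^ (n+1) * iq q (n + 1 - r) * iq q (n + r) with hv
    have sv : Summable v := by
      apply summable_of_ne_finset_zero (s := Finset.Icc (-(n:ℤ)) (n+1))
      intro r hr
      rw [Finset.mem_Icc, not_and_or] at hr
      rcases hr with h | h
      · simp only [hv]; rw [iq, iq, if_pos (show (n:ℤ) + r < 0 by omega), mul_zero]
      · simp only [hv]; rw [iq, iq, if_pos (show (n:ℤ) + 1 - r < 0 by omega), mul_zero, zero_mul]
    have sv' : Summable (fun r => v (r+1)) := sv.comp_injective (add_left_injective (1:ℤ))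
    have key : ∀ r, (1 - q^(n+1)) * (1 + q^(n+1)) * gt q (n+1) r - gt q n r = v r - v (r+1) := by
      intro r
      simp only [hv, gt]
      have a1 := iq_rec h0 h1 (n + 1 - r)
      have a2 := iq_rec h0 h1 (n + 1 + r)
      rw [show (n:ℤ) + 1 - r - 1 = n - r by ring] at a1
      rw [show (n:ℤ) + 1 + r - 1 = n + r by ring] at a2
      rw [show (n:ℤ) + 1 - (r+1) = n - r by ring, show (n:ℤ) + (r + 1) = n + 1 + r by ring]
      push_cast
      rw [a1, a2]
      have e1 : q ^ ((n:ℤ) + 1 - r) = q ^ (n+1) * (q ^ r)⁻¹ := by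
        rw [zpow_sub₀ h0.ne', div_eq_mul_inv]; congr 1
      have e2 : q ^ ((n:ℤ) + 1 + r) = q ^ (n+1) * (q ^ r) := by
        rw [zpow_add₀ h0.ne']; congr 1
      have e3 : q ^ (r^2 - r) = q ^ (r^2) * (q^r)⁻¹ := by
        rw [zpow_sub₀ h0.ne', div_eq_mul_inv]
      have e4 : q ^ ((r+1)^2 - (r+1)) = q ^ (r^2) * (q^r) := by
        rw [← zpow_add₀ h0.ne']; congr 1; ring
      have e5 : (-1:ℝ) ^ (r+1) = - (-1)^r := by
        rw [zpow_add₀ (by norm_num)]; simp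
      rw [e1, e2, e3, e4, e5]
      have hq0 : q ^ r ≠ 0 := zpow_ne_zero _ h0.ne'
      field_simp
      ring
    have ev : ∑' r, v (r+1) = ∑' r, v r := (Equiv.addRight (1:ℤ)).tsum_eq v
    have h2 : ∑' r, ((1 - q^(n+1)) * (1 + q^(n+1)) * gt q (n+1) r - gt q n r) = 0 := by
      rw [tsum_congr key, sv.tsum_sub sv', ev, sub_self]
    rw [((gt_summable q (n+1)).mul_left _).tsum_sub (gt_summable q n), tsum_mul_left] at h2
    have e4 : pq q (n+1) = pq q n * (1 - q^(n+1)) := by rw [pq, Finset.prod_range_succ, ← pq]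
    have e5 : mq q (n+1) = mq q n * (1 + q^(n+1)) := by rw [mq, Finset.prod_range_succ, ← mq]
    rw [e4, e5]
    linear_combination ih + (pq q n * mq q n) * h2

lemma q_sq_summable {q : ℝ} (h0 : 0 < q) (h1 : q < 1) : Summable (fun r : ℤ => q ^ (r^2)) := by
  have s0 := summable_geometric_of_lt_one h0.le h1
  have e : ∀ n : ℕ, q ^ ((n:ℤ)^2) ≤ q ^ n := by
    intro n
    have : q ^ ((n:ℤ)^2) = q ^ (n^2) := by exact_mod_cast rfl
    rw [this]
    exact pow_le_pow_of_le_one h0.le h1.le (Nat.le_self_pow two_ne_zero n)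
  apply Summable.of_nat_of_neg
  · exact Summable.of_nonneg_of_le (fun n => by positivity) e s0
  · refine Summable.of_nonneg_of_le (fun n => by positivity) (fun n => ?_) s0
    rw [neg_sq]; exact e n

/-- Gauss -/
lemma gauss {q : ℝ} (h0 : 0 < q) (h1 : q < 1) :
    ∑' r : ℤ, (-1 : ℝ) ^ r * q ^ (r ^ 2) = 1 / Fq q q := by
  obtain ⟨c, hc, hle, ht⟩ := pq_bound h0 h1
  have hb : ∀ k, iq q k ≤ 1 / c := by
    intro k; rw [iq]; split_ifs
    · positivity
    · exact one_div_le_one_div_of_le hc (hle _)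
  have T := tendsto_tsum_of_dominated_convergence (f := fun (n : ℕ) r => gt q n r)
    (g := fun r => (-1 : ℝ) ^ r * q ^ (r ^ 2) * (1/c) * (1/c)) (𝓕 := atTop)
    (bound := fun r => q ^ (r^2) * (1/c) * (1/c))
    (((q_sq_summable h0 h1).mul_right _).mul_right _) (fun r => by
      apply Tendsto.mul
      · apply Tendsto.const_mul
        simpa only [sub_eq_add_neg] using iq_tendsto hc ht (-r)
      · exact iq_tendsto hc ht r) (Eventually.of_forall fun n r => by
      rw [gt, norm_mul, norm_mul, norm_mul, Real.norm_of_nonneg (iq_nonneg h0 h1 _), Real.norm_of_nonneg (iq_nonneg h0 h1 _),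
        norm_zpow, norm_neg, norm_one, one_zpow, one_mul, Real.norm_of_nonneg (by positivity)]
      gcongr
      · exact iq_nonneg h0 h1 _
      · exact hb _
      · exact hb _)
  simp_rw [tsum_mul_right] at T
  have T2 := (T.mul ht).mul ht
  refine tendsto_nhds_unique ?_ (Pi_tendsto h0 h1)
  refine (T2.congr fun n => ?_).trans (le_of_eq ?_)
  · have := gt_sum h0 h1 n
    have h2 := mq_pos h0 n
    rw [eq_div_iff h2.ne']
    linear_combination (pq q n) * this
  · congr 1; field_simp

lemma cf_general (c b w : ℕ → ℝ) (hc : ∀ n, 0 < c (n+1)) (hb : ∀ n, 0 < b (n+1)) (hw : ∀ n, 0 < w n)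
    (hrec : ∀ n, w (n+2) = c (n+1) * w n - b (n+1) * w (n+1))
    (hev : ∀ᶠ n in atTop, c (n+2) ≤ (1/2) * (b (n+1) * b (n+2))) :
    CFTendsto c b (w 1 / w 0) := by
  have err : ∀ n, (cfNum c b n).1 * w 0 - w 1 * (cfDen c b n).1 = (-1)^n * w n ∧
      (cfNum c b n).2 * w 0 - w 1 * (cfDen c b n).2 = (-1)^(n+1) * w (n+1) := by
    intro n
    induction n with
    | zero => simp [cfNum, cfDen]
    | succ n ih =>
      simp only [cfNum, cfDen]
      refine ⟨ih.2, ?_⟩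
      rw [hrec]
      linear_combination b (n+1) * ih.2 + c (n+1) * ih.1
  have den : ∀ n, 0 ≤ (cfDen c b n).1 ∧ 0 < (cfDen c b n).2 := by
    intro n
    induction n with
    | zero => simp [cfDen]
    | succ n ih =>
      simp only [cfDen]
      have := hc n
      have := hb n
      have := ih.1
      have := ih.2
      exact ⟨by positivity, by positivity⟩
  have rho : Summable (fun n => w (n+1) / (cfDen c b n).2) := by
    apply summable_of_ratio_norm_eventually_le (r := 1/2) (by norm_num)
    filter_upwards [hev] with n hn
    have d0 := (den n).2
    have d1 := (den (n+1)).2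
    have w1 := hw (n+1)
    have w2 := hw (n+1+1)
    have w3 := hw (n+3)
    have b1 := hb n
    have b2 := hb (n+1)
    have d2 : b (n+1) * (cfDen c b n).2 ≤ (cfDen c b (n+1)).2 := by
      simp only [cfDen]
      have := mul_nonneg (hc n).le (den n).1
      linarith
    have r1 := hrec (n+1)
    rw [Real.norm_of_nonneg (by positivity), Real.norm_of_nonneg (by positivity), ← mul_div_assoc,
      div_le_div_iff₀ d1 d0]
    have h1 : b (n+2) * w (n+2) ≤ (1/2) * (b (n+1) * b (n+2)) * w (n+1) := by
      calc b (n+2) * w (n+2) ≤ c (n+2) * w (n+1) := by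
            have : w (n+3) = c (n+2) * w (n+1) - b (n+2) * w (n+2) := r1
            linarith
        _ ≤ _ := by gcongr
    have h2 : w (n+2) ≤ (1/2) * b (n+1) * w (n+1) := by
      have b2' : 0 < b (n+2) := b2
      by_contra hcon
      push Not at hcon
      nlinarith
    calc w (n+1+1) * (cfDen c b n).2 ≤ ((1/2) * b (n+1) * w (n+1)) * (cfDen c b n).2 := by gcongr
      _ = (1/2) * w (n+1) * (b (n+1) * (cfDen c b n).2) := by ring
      _ ≤ _ := by gcongr
  have t0 := rho.tendsto_atTop_zero
  unfold CFTendsto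
  rw [tendsto_iff_norm_sub_tendsto_zero]
  have t1 := t0.div_const (w 0)
  rw [zero_div] at t1
  refine t1.congr fun n => ?_
  have d0 := (den n).2
  have w0 := hw 0
  have wn := hw (n+1)
  rw [div_sub_div _ _ d0.ne' w0.ne', mul_comm (cfDen c b n).2 (w 1), (err n).2, norm_div, norm_mul, norm_pow, norm_neg, norm_one,
    one_pow, one_mul, Real.norm_of_nonneg wn.le, Real.norm_of_nonneg (by positivity), div_div]

noncomputable def Pp (q : ℝ) (n m : ℕ) : ℝ := ∏ i ∈ Finset.range m, (1 + q ^ (n + i))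
noncomputable def Dp (q : ℝ) (n m : ℕ) : ℝ := ∏ i ∈ Finset.range m, (1 - q ^ (2 * n + 1 + 2 * i))
noncomputable def Qp (q : ℝ) (m : ℕ) : ℝ := ∏ i ∈ Finset.range m, (1 - q ^ (2 * i + 2))
noncomputable def gc (q : ℝ) (n m : ℕ) : ℝ := Pp q n (2 * m) / (Dp q n m * Qp q m) * q ^ (2 * m)
noncomputable def Gs (q : ℝ) (n : ℕ) : ℝ := ∑' m, gc q n m

lemma one_sub_pos {q : ℝ} (h0 : 0 < q) (h1 : q < 1) {n : ℕ} (hn : n ≠ 0) : 0 < 1 - q ^ n :=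
  sub_pos.2 (pow_lt_one₀ h0.le h1 hn)

lemma Pp_pos {q : ℝ} (h0 : 0 < q) (n m : ℕ) : 0 < Pp q n m := Finset.prod_pos fun i _ => by positivity
lemma Dp_pos {q : ℝ} (h0 : 0 < q) (h1 : q < 1) (n m : ℕ) : 0 < Dp q n m :=
  Finset.prod_pos fun i _ => one_sub_pos h0 h1 (by omega)
lemma Qp_pos {q : ℝ} (h0 : 0 < q) (h1 : q < 1) (m : ℕ) : 0 < Qp q m :=
  Finset.prod_pos fun i _ => one_sub_pos h0 h1 (by omega)

lemma gc_pos {q : ℝ} (h0 : 0 < q) (h1 : q < 1) (n m : ℕ) : 0 < gc q n m := by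
  have := Pp_pos h0 n (2*m)
  have := Dp_pos h0 h1 n m
  have := Qp_pos h0 h1 m
  unfold gc; positivity

lemma gc_even {q : ℝ} (h0 : 0 < q) (h1 : q < 1) (m : ℕ) : gc q 0 m = hq q (2*m) * q ^ (2*m) := by
  rw [gc]; congr 1
  have d := Dp_pos h0 h1 0 m
  have Q := Qp_pos h0 h1 m
  rw [div_eq_iff (by positivity)]
  clear d Q
  induction m with
  | zero => simp [Pp, Dp, Qp, hq]
  | succ m ih =>
    have e1 : Pp q 0 (2*(m+1)) = Pp q 0 (2*m) * (1 + q^(2*m)) * (1+q^(2*m+1)) := by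
      simp only [Pp, show 2*(m+1) = 2*m+1+1 by ring, Finset.prod_range_succ, zero_add]
    have e2 : Dp q 0 (m+1) = Dp q 0 m * (1 - q^(2*m+1)) := by
      simp only [Dp, Finset.prod_range_succ]; ring_nf
    have e3 : Qp q (m+1) = Qp q m * (1 - q^(2*m+2)) := by
      simp only [Qp, Finset.prod_range_succ]
    have h2 := hq_succ h0 h1 (2*m)
    have h3 := hq_succ h0 h1 (2*m+1)
    rw [e1, e2, e3, ih, show 2*(m+1) = 2*m+1+1 by ring]
    linear_combination -(Dp q 0 m * Qp q m) * ((1 - q^(2*m+1)) * h3 + (1+q^(2*m+1)) * h2)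

lemma gc_odd {q : ℝ} (h0 : 0 < q) (h1 : q < 1) (m : ℕ) :
    2 * q / (1 - q) * gc q 1 m = hq q (2*m+1) * q ^ (2*m+1) := by
  have d := Dp_pos h0 h1 1 m
  have Q := Qp_pos h0 h1 m
  have hq1 : 0 < 1 - q := by linarith
  have : 2 * Pp q 1 (2*m) = hq q (2*m+1) * (Dp q 1 m * Qp q m * (1 - q)) := by
    clear d Q
    induction m with
    | zero =>
      simp [Pp, Dp, Qp, hq]; field_simp; norm_num
    | succ m ih =>
      have e1 : Pp q 1 (2*(m+1)) = Pp q 1 (2*m) * (1 + q^(2*m+1)) * (1+q^(2*m+2)) := by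
        simp only [Pp, show 2*(m+1) = 2*m+1+1 by ring, Finset.prod_range_succ]; ring_nf
      have e2 : Dp q 1 (m+1) = Dp q 1 m * (1 - q^(2*m+3)) := by
        simp only [Dp, Finset.prod_range_succ]; ring_nf
      have e3 : Qp q (m+1) = Qp q m * (1 - q^(2*m+2)) := by
        simp only [Qp, Finset.prod_range_succ]
      have h2 := hq_succ h0 h1 (2*m+1)
      have h3 := hq_succ h0 h1 (2*m+1+1)
      rw [e1, e2, e3, show 2*(m+1)+1 = 2*m+1+1+1 by ring]
      linear_combination (1 + q^(2*m+1)) * (1+q^(2*m+2)) * ih - (Dp q 1 m * Qp q m * (1-q)) * ((1 - q^(2*m+2)) * h3 + (1+q^(2*m+2)) * h2)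
  rw [gc]
  field_simp
  linear_combination (q * q^(2*m)) * this

lemma gc_le {q : ℝ} (h0 : 0 < q) (h1 : q < 1) (n m : ℕ) : gc q n m ≤ gc q 0 m := by
  unfold gc
  have d := Dp_pos h0 h1 0 m
  have Q := Qp_pos h0 h1 m
  have p := Pp_pos h0 0 (2*m)
  have a1 : Pp q n (2*m) ≤ Pp q 0 (2*m) := by
    unfold Pp
    apply Finset.prod_le_prod
    · intro i _; positivity
    · intro i _
      have := pow_le_pow_of_le_one h0.le h1.le (show 0 + i ≤ n + i by omega)
      linarith
  have a2 : Dp q 0 m ≤ Dp q n m := by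
    unfold Dp
    apply Finset.prod_le_prod
    · intro i _; exact (one_sub_pos h0 h1 (by omega)).le
    · intro i _
      have := pow_le_pow_of_le_one h0.le h1.le (show 2 * 0 + 1 + 2 * i ≤ 2 * n + 1 + 2 * i by omega)
      linarith
  gcongr

lemma gc_summable {q : ℝ} (h0 : 0 < q) (h1 : q < 1) (n : ℕ) : Summable (gc q n) := by
  refine Summable.of_nonneg_of_le (fun m => (gc_pos h0 h1 n m).le) (gc_le h0 h1 n) ?_
  have := (hq_summable h0 h1 q (by rwa [abs_of_pos h0])).comp_injective (mul_right_injective₀ (two_ne_zero (α := ℕ)))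
  refine this.congr fun m => ?_
  exact (gc_even h0 h1 m).symm

lemma Gs_pos {q : ℝ} (h0 : 0 < q) (h1 : q < 1) (n : ℕ) : 0 < Gs q n :=
  (gc_summable h0 h1 n).tsum_pos (fun m => (gc_pos h0 h1 n m).le) 0 (gc_pos h0 h1 n 0)

lemma gc_contig {q : ℝ} (h0 : 0 < q) (h1 : q < 1) (n m : ℕ) :
    gc q n (m+1) - gc q (n+1) (m+1) =
      q^2 * q^n * (1 + q^(n+1))^2 / ((1 - q^(2*n+1)) * (1 - q^(2*n+3))) * gc q (n+2) m := by
  have d := Dp_pos h0 h1 (n+2) m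
  have Q := Qp_pos h0 h1 m
  have x1 := one_sub_pos h0 h1 (show 2*n+1 ≠ 0 by omega)
  have x2 := one_sub_pos h0 h1 (show 2*n+3 ≠ 0 by omega)
  have x3 := one_sub_pos h0 h1 (show 2*n+2*m+3 ≠ 0 by omega)
  have x4 := one_sub_pos h0 h1 (show 2*m+2 ≠ 0 by omega)
  have e1 : Pp q n (2*(m+1)) = (1+q^n) * (1 + q^(n+1)) * Pp q (n+2) (2*m) := by
    simp only [Pp, show 2*(m+1) = 2*m+1+1 by ring, Finset.prod_range_succ']
    rw [mul_comm, ← mul_assoc, mul_right_comm, mul_comm]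
    simp only [add_comm, add_left_comm, add_zero]
    ring_nf
  have e2 : Pp q (n+1) (2*(m+1)) = (1+q^(n+1)) * Pp q (n+2) (2*m) * (1 + q^(n+2+2*m)) := by
    simp only [Pp, show 2*(m+1) = 2*m+1+1 by ring]
    rw [Finset.prod_range_succ, Finset.prod_range_succ']
    ring_nf
  have e3 : Dp q (n+1) (m+1) = (1 - q^(2*n+3)) * Dp q (n+2) m := by
    simp only [Dp, Finset.prod_range_succ']
    ring_nf
  have e4 : Dp q n (m+1) * (1 - q^(2*n+2*m+3)) = (1 - q^(2*n+1)) * (1 - q^(2*n+3)) * Dp q (n+2) m := by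
    have : Dp q n (m+1) * (1 - q^(2*n+2*m+3)) = Dp q n (m+2) := by
      simp only [Dp]; rw [Finset.prod_range_succ _ (m+1)]; ring_nf
    rw [this]
    simp only [Dp, Finset.prod_range_succ']
    ring_nf
  have e4' : Dp q n (m+1) = (1 - q^(2*n+1)) * (1 - q^(2*n+3)) * Dp q (n+2) m / (1 - q^(2*n+2*m+3)) := by
    rw [eq_div_iff x3.ne', e4]
  have e5 : Qp q (m+1) = Qp q m * (1 - q^(2*m+2)) := by
    simp only [Qp, Finset.prod_range_succ]
  simp only [gc]
  rw [e1, e2, e3, e4', e5]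
  field_simp
  ring

lemma Gs_contig {q : ℝ} (h0 : 0 < q) (h1 : q < 1) (n : ℕ) :
    Gs q n - Gs q (n+1) =
      q^2 * q^n * (1 + q^(n+1))^2 / ((1 - q^(2*n+1)) * (1 - q^(2*n+3))) * Gs q (n+2) := by
  have s := (gc_summable h0 h1 n).sub (gc_summable h0 h1 (n+1))
  have e0 : ∀ n, gc q n 0 = 1 := fun n => by simp [gc, Pp, Dp, Qp]
  rw [Gs, Gs, Gs, ← (gc_summable h0 h1 n).tsum_sub (gc_summable h0 h1 (n+1)), s.tsum_eq_zero_add,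
    ← tsum_mul_left, e0, e0, sub_self, zero_add]
  exact tsum_congr fun m => gc_contig h0 h1 n m

lemma EO {q : ℝ} (h0 : 0 < q) (h1 : q < 1) :
    Gs q 0 + 2 * q / (1 - q) * Gs q 1 = Fq q q ∧ Gs q 0 - 2 * q / (1 - q) * Gs q 1 = Fq q (-q) := by
  have s1 := gc_summable h0 h1 0
  have s2 := (gc_summable h0 h1 1).mul_left (2 * q / (1 - q))
  have f1 : Fq q q = ∑' m, hq q (2*m) * q^(2*m) + ∑' m, hq q (2*m+1) * q^(2*m+1) :=
    (tsum_even_add_odd (f := fun n => hq q n * q ^ n) (s1.congr fun m => gc_even h0 h1 m) (s2.congr fun m => gc_odd h0 h1 m)).symm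
  have f2 : Fq q (-q) = ∑' m, hq q (2*m) * (-q)^(2*m) + ∑' m, hq q (2*m+1) * (-q)^(2*m+1) := by
    refine (tsum_even_add_odd (f := fun n => hq q n * (-q) ^ n) (s1.congr fun m => ?_) (s2.neg.congr fun m => ?_)).symm
    · rw [gc_even h0 h1]; simp [pow_mul]
    · rw [gc_odd h0 h1]; simp [pow_succ, pow_mul]
  have g0 : Gs q 0 = ∑' m, hq q (2*m) * q^(2*m) := tsum_congr fun m => gc_even h0 h1 m
  have g1 : 2 * q / (1 - q) * Gs q 1 = ∑' m, hq q (2*m+1) * q^(2*m+1) := by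
    rw [Gs, ← tsum_mul_left]; exact tsum_congr fun m => gc_odd h0 h1 m
  constructor
  · rw [f1, g0, g1]
  · rw [f2, g0, g1, sub_eq_add_neg, ← tsum_neg]
    congr 1
    · simp [pow_mul]
    · simp [pow_succ, pow_mul]

theorem cf_main {q : ℝ} (h0 : 0 < q) (h1 : q < 1) : ∃ L : ℝ,
      CFTendsto
        (fun n => if n = 1 then 2 * q else q ^ 2 * q ^ (n - 2) * (1 + q ^ (n - 1)) ^ 2)
        (fun n => 1 - q ^ (2 * n - 1)) L ∧
      L ≠ 1 ∧
      -1 + 2 / (1 - L) = 1 / (∑' r : ℤ, (-1 : ℝ) ^ r * q ^ (r ^ 2)) ^ 2 := by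
  set c : ℕ → ℝ := (fun n => if n = 1 then 2 * q else q ^ 2 * q ^ (n - 2) * (1 + q ^ (n - 1)) ^ 2) with hc
  set b : ℕ → ℝ := (fun n => 1 - q ^ (2 * n - 1)) with hb
  have c1 : c 1 = 2 * q := by simp [hc]
  have c2 : ∀ n, c (n+2) = q^2 * q^n * (1+q^(n+1))^2 := fun n => by simp [hc]
  have b1 : ∀ n, b (n+1) = 1 - q^(2*n+1) := fun n => by
    simp only [hb]; congr 2
  have cpos : ∀ n, 0 < c (n+1) := by
    intro n
    rcases n with _ | n
    · rw [c1]; positivity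
    · rw [c2]; positivity
  have bpos : ∀ n, 0 < b (n+1) := fun n => by rw [b1]; exact one_sub_pos h0 h1 (by omega)
  set w : ℕ → ℝ := fun n => (∏ i ∈ Finset.range n, c (i+1) / b (i+1)) * Gs q n with hw
  have wpos : ∀ n, 0 < w n := fun n => mul_pos (Finset.prod_pos fun i _ => div_pos (cpos i) (bpos i)) (Gs_pos h0 h1 n)
  have main := cf_general c b w cpos bpos wpos (by
      intro n
      simp only [hw, Finset.prod_range_succ]
      have := Gs_contig h0 h1 n
      have hb1 := bpos n
      have hb2 := bpos (n+1)
      rw [← c2, ← b1, show 2*n+3 = 2*(n+1)+1 by ring, ← b1] at this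
      have e : Gs q n = Gs q (n+1) + c (n+2) / (b (n+1) * b (n+1+1)) * Gs q (n+2) := by linarith
      rw [e]
      field_simp
      ring) (by
      have t0 : Tendsto (fun n : ℕ => q ^ n) atTop (𝓝 0) :=
        tendsto_pow_atTop_nhds_zero_of_lt_one h0.le h1
      have t1 := tend_pow h0 h1
      have inj : Tendsto (fun n : ℕ => 2*n+1) atTop atTop :=
        tendsto_atTop_mono (fun n => (by omega : n ≤ 2*n+1)) tendsto_id
      have tb : Tendsto (fun n => b (n+1)) atTop (𝓝 1) := by
        simp_rw [b1]
        simpa using (t0.comp inj).const_sub 1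
      have tb2 : Tendsto (fun n => b (n+2)) atTop (𝓝 1) := (tendsto_add_atTop_iff_nat 1).2 tb
      have tc : Tendsto (fun n => c (n+2)) atTop (𝓝 0) := by
        simp_rw [c2]
        simpa using (t0.const_mul (q^2)).mul ((t1.const_add 1).pow 2)
      have tr : Tendsto (fun n => (1/2) * (b (n+1) * b (n+2))) atTop (𝓝 (1/2)) := by
        simpa using (tb.mul tb2).const_mul (1/2 : ℝ)
      filter_upwards [tc.eventually_le_const (show (0:ℝ) < 1/4 by norm_num),
        tr.eventually_const_le (show (1/4:ℝ) < 1/2 by norm_num)] with n ha hb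
      linarith)
  have w0 : w 0 = Gs q 0 := by simp [hw]
  have w1 : w 1 = 2 * q / (1 - q) * Gs q 1 := by simp [hw, c1, b1 0]
  obtain ⟨e1, e2⟩ := EO h0 h1
  rw [← w0, ← w1] at e1 e2
  have F1 := Fq_pos h0 h1
  rw [Fq_neg h0 h1] at e2
  have p0 := wpos 0
  have hd : 0 < w 0 - w 1 := by rw [e2]; positivity
  refine ⟨_, main, ?_, ?_⟩
  · rw [Ne, div_eq_one_iff_eq p0.ne']
    linarith
  · rw [gauss h0 h1, ← e2]
    have : 1 - w 1 / w 0 = (w 0 - w 1) / w 0 := by field_simp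
    rw [this]
    have e3 : (w 0 + w 1) * (w 0 - w 1) = 1 := by
      rw [e1, e2]; field_simp
    field_simp
    linear_combination e3

/-! ### Theta functions -/

noncomputable def tf (s : ℝ) (n : ℤ) : ℝ := Real.exp (-Real.pi * s * (n:ℝ)^2)
noncomputable def Tt (s : ℝ) : ℝ := ∑' n : ℤ, tf s n
noncomputable def Vt (s : ℝ) : ℝ := ∑' n : ℤ, (-1:ℝ)^n * tf s n

lemma tf_eq (s : ℝ) (n : ℤ) : tf s n = Real.exp (-Real.pi * s) ^ (n^2) := by
  have e : ((n^2 : ℤ) : ℝ) * (-Real.pi * s) = -Real.pi * s * (n:ℝ)^2 := by push_cast; ring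
  rw [tf, ← Real.rpow_intCast, ← Real.exp_mul, ← e, mul_comm]

lemma exp_lt {s : ℝ} (hs : 0 < s) : Real.exp (-Real.pi * s) < 1 := by
  rw [Real.exp_lt_one_iff]; nlinarith [Real.pi_pos]

lemma tf_summable {s : ℝ} (hs : 0 < s) : Summable (tf s) :=
  (q_sq_summable (Real.exp_pos _) (exp_lt hs)).congr fun n => (tf_eq s n).symm

lemma tf_pos (s : ℝ) (n : ℤ) : 0 < tf s n := Real.exp_pos _

lemma vf_norm (s : ℝ) (n : ℤ) : ‖(-1:ℝ)^n * tf s n‖ = tf s n := by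
  rw [norm_mul, norm_zpow, norm_neg, norm_one, one_zpow, one_mul, Real.norm_of_nonneg (tf_pos s n).le]

lemma vf_summable {s : ℝ} (hs : 0 < s) : Summable (fun n : ℤ => (-1:ℝ)^n * tf s n) := by
  apply Summable.of_norm
  simp_rw [vf_norm]
  exact tf_summable hs

lemma T_add_V {s : ℝ} (hs : 0 < s) : Tt s + Vt s = 2 * Tt (4 * s) := by
  rw [Tt, Vt, Tt, ← (tf_summable hs).tsum_add (vf_summable hs), ← tsum_mul_left]
  have inj : Function.Injective (fun n : ℤ => 2 * n) := fun a b h => by simpa using h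
  rw [← inj.tsum_eq]
  · apply tsum_congr
    intro n
    have e : (-1:ℝ)^(2*n) = 1 := by rw [zpow_mul]; norm_num
    rw [e, tf, tf]
    push_cast
    ring_nf
  · intro n hn
    rcases Int.even_or_odd n with h | h
    · obtain ⟨k, rfl⟩ := h
      exact ⟨k, by simp; ring⟩
    · exfalso; apply hn
      simp [h.neg_one_zpow]

lemma T_sq_add_V_sq {s : ℝ} (hs : 0 < s) : Tt s ^ 2 + Vt s ^ 2 = 2 * Tt (2 * s) ^ 2 := by
  have n1 : Summable (fun n => ‖tf s n‖) := (tf_summable hs).norm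
  have n2 : Summable (fun n : ℤ => ‖(-1:ℝ)^n * tf s n‖) := (vf_summable hs).norm
  have n3 : Summable (fun n => ‖tf (2*s) n‖) := (tf_summable (by positivity)).norm
  rw [sq, sq, sq, Tt, Vt, Tt, tsum_mul_tsum_of_summable_norm n1 n1, tsum_mul_tsum_of_summable_norm n2 n2,
    tsum_mul_tsum_of_summable_norm n3 n3, ← (summable_mul_of_summable_norm n1 n1).tsum_add (summable_mul_of_summable_norm n2 n2),
    ← tsum_mul_left]
  have inj : Function.Injective (fun p : ℤ × ℤ => (p.1 + p.2, p.1 - p.2)) := by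
    rintro ⟨a, b⟩ ⟨c, d⟩ h
    simp only [Prod.mk.injEq] at h ⊢
    omega
  rw [← inj.tsum_eq]
  · apply tsum_congr
    rintro ⟨a, b⟩
    have e : (-1:ℝ)^(a+b) * (-1:ℝ)^(a-b) = 1 := by
      rw [← zpow_add₀ (by norm_num), show a + b + (a - b) = 2 * a by ring, zpow_mul]; norm_num
    have e2 : tf s (a+b) * tf s (a-b) = tf (2*s) a * tf (2*s) b := by
      rw [tf, tf, tf, tf, ← Real.exp_add, ← Real.exp_add]; congr 1; push_cast; ring
    simp only
    linear_combination (tf s (a+b) * tf s (a-b)) * e + 2 * e2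
  · rintro ⟨m, n⟩ hn
    rcases Int.even_or_odd (m+n) with h | h
    · obtain ⟨k, hk⟩ := h
      exact ⟨(k, m - k), by simp; omega⟩
    · exfalso; apply hn
      have e : (-1:ℝ)^m * (-1:ℝ)^n = -1 := by
        rw [← zpow_add₀ (by norm_num), h.neg_one_zpow]
      simp only
      linear_combination (tf s m * tf s n) * e

lemma T_inv {s : ℝ} (hs : 0 < s) : Tt (1/s) = √s * Tt s := by
  have := Real.tsum_exp_neg_mul_int_sq (a := s) hs
  rw [← Real.sqrt_eq_rpow] at this
  have h1 : Tt s = 1 / √s * Tt (1/s) := by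
    rw [Tt, Tt]
    simp only [tf]
    rw [this]
    congr 2; ext n; congr 1; ring
  have := Real.sqrt_pos.2 hs
  rw [h1]; field_simp

noncomputable def Ut (s : ℝ) : ℝ := Tt (s/4) - Tt s

lemma V_inv {s : ℝ} (hs : 0 < s) : Vt (1/s) = √s * Ut s := by
  have h1 := T_add_V (s := 1/s) (by positivity)
  have h2 := T_inv (s := s/4) (by positivity)
  rw [T_inv hs, show 4 * (1/s) = 1/(s/4) by field_simp, h2] at h1
  have h3 : √(s/4) = √s / 2 := by
    rw [Real.sqrt_div hs.le, show (4:ℝ) = 2^2 by norm_num, Real.sqrt_sq (by norm_num)]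
  rw [h3] at h1
  rw [Ut]
  linear_combination h1

lemma U_pos {s : ℝ} (hs : 0 < s) : 0 < Ut s := by
  rw [Ut, sub_pos]
  apply Summable.tsum_lt_tsum (i := 1) _ _ (tf_summable hs) (tf_summable (by positivity))
  · intro n
    simp only [tf]
    apply Real.exp_le_exp.2
    have := mul_nonneg (mul_nonneg Real.pi_pos.le hs.le) (sq_nonneg (n:ℝ))
    nlinarith
  · simp only [tf]
    apply Real.exp_lt_exp.2
    have := mul_pos Real.pi_pos hs
    push_cast
    nlinarith

lemma V_pos {s : ℝ} (hs : 0 < s) : 0 < Vt s := by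
  have := V_inv (s := 1/s) (by positivity)
  rw [one_div_one_div] at this
  rw [this]
  exact mul_pos (Real.sqrt_pos.2 (by positivity)) (U_pos (by positivity))

lemma V_le_T {s : ℝ} (hs : 0 < s) : Vt s ≤ Tt s :=
  (vf_summable hs).tsum_le_tsum (fun n => (le_abs_self _).trans (vf_norm s n).le) (tf_summable hs)

lemma T_pos {s : ℝ} (hs : 0 < s) : 0 < Tt s := (V_pos hs).trans_le (V_le_T hs)

lemma T_mul_V {s : ℝ} (hs : 0 < s) : Tt s * Vt s = Vt (2 * s) ^ 2 := by
  have a1 := T_add_V hs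
  have a2 := T_add_V (s := 2*s) (by positivity)
  have b1 := T_sq_add_V_sq hs
  have b2 := T_sq_add_V_sq (s := 2*s) (by positivity)
  rw [show 2 * (2 * s) = 4 * s by ring] at b2
  have : (Tt s + Vt s)^2 = 4 * Tt (4*s)^2 := by rw [a1]; ring
  nlinarith

lemma jacobi {s : ℝ} (hs : 0 < s) : Ut s ^ 4 + Vt s ^ 4 = Tt s ^ 4 := by
  have a0 := T_add_V (s := s/4) (by positivity)
  have a1 := T_add_V (s := s/2) (by positivity)
  have b0 := T_sq_add_V_sq (s := s/4) (by positivity)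
  have b1 := T_sq_add_V_sq (s := s/2) (by positivity)
  have m1 := T_mul_V (s := s/2) (by positivity)
  rw [show 2 * (s/2) = s by ring] at b1 m1
  rw [show 4 * (s/4) = s by ring] at a0
  rw [show 2 * (s/4) = s/2 by ring] at b0
  have eV : Vt (s/4) = 2 * Tt s - Tt (s/4) := by linarith
  have eV2 : Vt (s/2) = 2 * Tt (4 * (s/2)) - Tt (s/2) := by linarith
  have u2 : Ut s ^ 2 = Tt (s/2)^2 - Tt s ^ 2 := by
    rw [eV] at b0; rw [Ut]; linear_combination (1/2) * b0
  have e1 : Ut s ^ 4 = (Tt (s/2)^2 - Tt s ^ 2)^2 := by rw [← u2]; ring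
  have e2 : Vt s ^ 4 = (Tt (s/2) * Vt (s/2))^2 := by rw [m1]; ring
  have e3 : Tt s ^ 2 = (Tt (s/2)^2 + Vt (s/2)^2)/2 := by linarith
  have e4 : Tt s ^ 4 = ((Tt (s/2)^2 + Vt (s/2)^2)/2)^2 := by rw [← e3]; ring
  rw [e1, e2, e4, e3]; ring

lemma T_tendsto : Tendsto Tt atTop (𝓝 1) := by
  have := tendsto_tsum_of_dominated_convergence (f := fun (s : ℝ) n => tf s n)
    (g := fun n : ℤ => if n = 0 then (1:ℝ) else 0) (𝓕 := atTop) (tf_summable one_pos) (fun n => by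
      split_ifs with h
      · simp [tf, h]
      · simp only [tf]
        apply Real.tendsto_exp_atBot.comp
        have hn : 0 < Real.pi * (n:ℝ)^2 := by
          have : (n:ℝ) ≠ 0 := by exact_mod_cast h
          positivity
        have := (tendsto_id (α := ℝ)).const_mul_atTop hn
        refine (tendsto_neg_atTop_atBot.comp this).congr fun s => ?_
        simp; ring) (by
      filter_upwards [eventually_ge_atTop 1] with s hs n
      rw [Real.norm_of_nonneg (tf_pos s n).le]
      simp only [tf]
      apply Real.exp_le_exp.2
      have := mul_nonneg Real.pi_pos.le (sq_nonneg (n:ℝ))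
      nlinarith)
  rw [tsum_ite_eq] at this
  exact this

lemma V_tendsto : Tendsto Vt atTop (𝓝 1) := by
  have h4 : Tendsto (fun s : ℝ => 4 * s) atTop atTop := tendsto_id.const_mul_atTop (by norm_num)
  have := ((T_tendsto.comp h4).const_mul 2).sub T_tendsto
  norm_num at this
  refine this.congr' ?_
  filter_upwards [eventually_gt_atTop 0] with s hs
  have := T_add_V hs
  linarith

/-! ### Elliptic integrals -/
open MeasureTheory Set

noncomputable def Ie (a b : ℝ) : ℝ := ∫ x in Ioi (0:ℝ), 1 / √((x^2+a^2) * (x^2+b^2))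

lemma Ie_scale {l : ℝ} (hl : 0 < l) (a b : ℝ) : Ie (l * a) (l * b) = l⁻¹ * Ie a b := by
  have h := integral_comp_mul_left_Ioi (fun x => 1 / √((x^2+(l*a)^2) * (x^2+(l*b)^2))) 0 hl
  rw [mul_zero, smul_eq_mul] at h
  have h2 : ∫ x in Ioi (0:ℝ), 1 / √(((l*x)^2+(l*a)^2) * ((l*x)^2+(l*b)^2)) = (l^2)⁻¹ * Ie a b := by
    rw [Ie, ← integral_const_mul]
    congr 1; ext x
    rw [show ((l*x)^2+(l*a)^2) * ((l*x)^2+(l*b)^2) = (l^2)^2 * ((x^2+a^2) * (x^2+b^2)) by ring,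
      Real.sqrt_mul (by positivity), Real.sqrt_sq (by positivity)]
    rw [one_div, mul_inv, one_div]
  rw [h2] at h
  rw [Ie]
  have : Ie a b = l^2 * (l⁻¹ * ∫ x in Ioi (0:ℝ), 1 / √((x^2+(l*a)^2) * (x^2+(l*b)^2))) := by
    rw [← h]; field_simp
  rw [this]; field_simp

lemma Kint_eq_Ie {x b : ℝ} (hb : 0 < b) (hx : x^2 = 1 - b^2) : Kint x = Ie 1 b := by
  have hpi := Real.pi_pos
  have img : (fun t => b * Real.tan t) '' Ioo 0 (Real.pi/2) = Ioi 0 := by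
    ext y; constructor
    · rintro ⟨t, ht, rfl⟩
      exact mul_pos hb (Real.tan_pos_of_pos_of_lt_pi_div_two ht.1 ht.2)
    · intro hy
      have hy : 0 < y := hy
      refine ⟨Real.arctan (y/b), ⟨Real.arctan_pos.2 (by positivity), Real.arctan_lt_pi_div_two _⟩, ?_⟩
      simp only [Real.tan_arctan]; field_simp
  have hcos : ∀ t ∈ Ioo 0 (Real.pi/2), 0 < Real.cos t := fun t ht =>
    Real.cos_pos_of_mem_Ioo ⟨by linarith [ht.1], ht.2⟩
  have cv := integral_image_eq_integral_abs_deriv_smul (s := Ioo 0 (Real.pi/2)) (f := fun t => b * Real.tan t)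
    (f' := fun t => b * (1 / Real.cos t ^ 2)) measurableSet_Ioo
    (fun t ht => ((Real.hasDerivAt_tan (hcos t ht).ne').const_mul b).hasDerivWithinAt)
    (fun t ht u hu h => by
      apply Real.injOn_tan ⟨by linarith [ht.1], ht.2⟩ ⟨by linarith [hu.1], hu.2⟩
      exact mul_left_cancel₀ hb.ne' h)
    (fun y => 1 / √((y^2+1^2) * (y^2+b^2)))
  rw [img] at cv
  rw [Ie, cv, Kint, intervalIntegral.integral_of_le (by positivity), integral_Ioc_eq_integral_Ioo]
  apply setIntegral_congr_fun measurableSet_Ioo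
  intro t ht
  have hc := hcos t ht
  have hs := Real.sin_sq_add_cos_sq t
  simp only [smul_eq_mul]
  rw [abs_of_pos (by positivity), Real.tan_eq_sin_div_cos]
  have e1 : 1 - x^2 * Real.sin t ^2 = Real.cos t ^ 2 + b^2 * Real.sin t ^2 := by rw [hx]; linear_combination -hs
  have hp : 0 < Real.cos t ^ 2 + b^2 * Real.sin t ^2 := by positivity
  have e2 : ((b * (Real.sin t / Real.cos t))^2+1^2) * ((b * (Real.sin t / Real.cos t))^2+b^2)
      = (b / Real.cos t ^2)^2 * (Real.cos t ^ 2 + b^2 * Real.sin t ^2) := by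
    field_simp
    linear_combination ((Real.cos t ^ 2 + b^2 * Real.sin t ^2)) * hs
  rw [e1, e2, Real.sqrt_mul (by positivity), Real.sqrt_sq (by positivity)]
  have := Real.sqrt_pos.2 hp
  field_simp

lemma landen {a b : ℝ} (ha : 0 < a) (hb : 0 < b) : Ie ((a+b)/2) (√(a*b)) = Ie a b := by
  have hab : 0 < a * b := by positivity
  set F : ℝ → ℝ := fun u => 1 / √((u^2+((a+b)/2)^2) * (u^2+(√(a*b))^2)) with hF
  have img : (fun x => (x - a*b/x)/2) '' Ioi 0 = univ := by
    apply eq_univ_of_forall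
    intro u
    have h1 : |u| < √(u^2 + a*b) := by
      rw [← Real.sqrt_sq_eq_abs]; exact Real.sqrt_lt_sqrt (sq_nonneg _) (by linarith)
    have h2 : 0 < u + √(u^2+a*b) := by
      have := neg_abs_le u; linarith
    refine ⟨u + √(u^2+a*b), h2, ?_⟩
    have h3 := Real.sq_sqrt (show 0 ≤ u^2 + a*b by positivity)
    simp only
    field_simp
    linear_combination h3
  have cv := integral_image_eq_integral_abs_deriv_smul (s := Ioi 0) (f := fun x => (x - a*b/x)/2)
    (f' := fun x => (1 + a*b/x^2)/2) measurableSet_Ioi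
    (fun x hx => by
      have hx : 0 < x := hx
      have := (((hasDerivAt_id x).sub ((hasDerivAt_inv hx.ne').const_mul (a*b))).div_const 2).hasDerivWithinAt (s := Ioi 0)
      refine (this.congr_deriv ?_).congr_of_mem ?_ hx
      · field_simp; ring
      · intro y _; simp [div_eq_mul_inv])
    (fun x hx y hy h => by
      have hx : 0 < x := hx
      have hy : 0 < y := hy
      simp only at h
      field_simp at h
      have : (x - y) * (x*y + a*b) = 0 := by linear_combination h
      rcases mul_eq_zero.1 this with h | h
      · linarith
      · have := mul_pos hx hy; linarith) F
  rw [img, setIntegral_univ] at cv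
  have ev : ∫ x, F x = 2 * ∫ x in Ioi (0:ℝ), F x := by
    rw [← integral_comp_abs]
    simp only [hF, sq_abs]
  have rhs : ∫ x in Ioi (0:ℝ), |(1 + a*b/x^2)/2| • F ((x - a*b/x)/2) = 2 * Ie a b := by
    rw [Ie, ← integral_const_mul]
    apply setIntegral_congr_fun measurableSet_Ioi
    intro x hx
    have hx : 0 < x := hx
    simp only [smul_eq_mul, hF]
    rw [abs_of_pos (by positivity), Real.sq_sqrt hab.le]
    have e : (((x - a*b/x)/2)^2 + ((a+b)/2)^2) * (((x - a*b/x)/2)^2 + a*b) =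
        ((x^2+a*b)/(4*x^2))^2 * ((x^2+a^2)*(x^2+b^2)) := by
      field_simp; ring
    rw [e, Real.sqrt_mul (by positivity), Real.sqrt_sq (by positivity)]
    have : 0 < √((x^2+a^2)*(x^2+b^2)) := Real.sqrt_pos.2 (by positivity)
    field_simp
    ring
  rw [rhs, ev] at cv
  have : Ie ((a+b)/2) (√(a*b)) = ∫ x in Ioi (0:ℝ), F x := rfl
  rw [this]; linarith

lemma K_cont {x : ℝ} (h1 : x^2 < 1) : Continuous (fun t => 1 / √(1 - x ^ 2 * Real.sin t ^ 2)) := by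
  apply Continuous.div continuous_const (by fun_prop)
  intro t
  apply (Real.sqrt_pos.2 _).ne'
  have := Real.sin_sq_le_one t
  nlinarith [sq_nonneg x, sq_nonneg (Real.sin t)]

lemma K_bounds {x : ℝ} (h1 : x^2 < 1) : Real.pi/2 ≤ Kint x ∧ Kint x ≤ Real.pi/2 * (1 / √(1 - x^2)) := by
  have hpi := Real.pi_pos
  have ii := (K_cont h1).intervalIntegrable (μ := volume) 0 (Real.pi/2)
  constructor
  · have := intervalIntegral.integral_mono_on (f := fun _ => (1:ℝ)) (by positivity) (by simp) ii (fun t _ => by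
      have := Real.sin_sq_le_one t
      have h2 : 0 < √(1 - x ^ 2 * Real.sin t ^ 2) := by
        apply Real.sqrt_pos.2; nlinarith [sq_nonneg x, sq_nonneg (Real.sin t)]
      rw [le_div_iff₀ h2, one_mul, Real.sqrt_le_one]
      nlinarith [mul_nonneg (sq_nonneg x) (sq_nonneg (Real.sin t))])
    simpa [Kint] using this
  · have := intervalIntegral.integral_mono_on (g := fun _ => 1 / √(1 - x^2)) (by positivity) ii (by simp) (fun t _ => by
      have := Real.sin_sq_le_one t
      have h2 : 0 < √(1 - x ^ 2) := Real.sqrt_pos.2 (by linarith)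
      apply one_div_le_one_div_of_le h2
      apply Real.sqrt_le_sqrt
      nlinarith [sq_nonneg x])
    simpa [Kint] using this

lemma K_strict {x y : ℝ} (h0 : 0 ≤ x) (hxy : x < y) (hy : y < 1) : Kint x < Kint y := by
  have hpi := Real.pi_pos
  have hx2 : x^2 < y^2 := by nlinarith
  have hy2 : y^2 < 1 := by nlinarith
  have pos : ∀ t, 0 < 1 - y ^ 2 * Real.sin t ^ 2 := fun t => by
    have := Real.sin_sq_le_one t
    nlinarith [sq_nonneg y, sq_nonneg (Real.sin t)]
  apply intervalIntegral.integral_lt_integral_of_continuousOn_of_le_of_exists_lt (by positivity)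
    (K_cont (by linarith)).continuousOn (K_cont hy2).continuousOn
  · intro t _
    apply one_div_le_one_div_of_le (Real.sqrt_pos.2 (pos t))
    apply Real.sqrt_le_sqrt
    nlinarith [sq_nonneg (Real.sin t)]
  · refine ⟨Real.pi/2, ⟨by positivity, le_rfl⟩, ?_⟩
    apply one_div_lt_one_div_of_lt (Real.sqrt_pos.2 (pos _))
    apply Real.sqrt_lt_sqrt (pos _).le
    rw [Real.sin_pi_div_two]
    linarith

lemma Ie_bounds {a b : ℝ} (hb : 0 < b) (hab : b ≤ a) :
    Real.pi/2 / a ≤ Ie a b ∧ Ie a b ≤ Real.pi/2 / b := by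
  have ha : 0 < a := by linarith
  have hr : 0 < b/a := by positivity
  have hr1 : b/a ≤ 1 := (div_le_one ha).2 hab
  have hn : 0 ≤ 1 - (b/a)^2 := by nlinarith
  have e : Ie a b = a⁻¹ * Ie 1 (b/a) := by
    rw [← Ie_scale ha]; congr 1
    · ring
    · field_simp
  have hx : (√(1 - (b/a)^2))^2 = 1 - (b/a)^2 := Real.sq_sqrt hn
  rw [← Kint_eq_Ie hr hx] at e
  have := K_bounds (x := √(1 - (b/a)^2)) (by rw [hx]; nlinarith)
  rw [hx, sub_sub_cancel, Real.sqrt_sq hr.le] at this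
  rw [e]
  constructor
  · rw [div_eq_inv_mul]; have := this.1; gcongr
  · calc _ ≤ a⁻¹ * (Real.pi/2 * (1/(b/a))) := by have := this.2; gcongr
      _ = _ := by field_simp

lemma Ie_theta {s : ℝ} (hs : 0 < s) : Ie (Tt s ^ 2) (Vt s ^ 2) = Real.pi / 2 := by
  have step : ∀ s : ℝ, 0 < s → Ie (Tt (2*s) ^ 2) (Vt (2*s) ^ 2) = Ie (Tt s ^ 2) (Vt s ^ 2) := by
    intro s hs
    have h1 := T_pos hs
    have h2 := V_pos hs
    rw [← landen (by positivity : 0 < Tt s ^ 2) (by positivity : 0 < Vt s ^ 2)]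
    congr 1
    · rw [T_sq_add_V_sq hs]; ring
    · rw [← mul_pow, Real.sqrt_sq (by positivity), T_mul_V hs]
  have iter : ∀ n : ℕ, Ie (Tt (2^n*s) ^ 2) (Vt (2^n*s) ^ 2) = Ie (Tt s ^ 2) (Vt s ^ 2) := by
    intro n
    induction n with
    | zero => simp
    | succ n ih => rw [← ih, ← step (2^n*s) (by positivity)]; ring_nf
  have t : Tendsto (fun n : ℕ => (2:ℝ)^n * s) atTop atTop :=
    (tendsto_pow_atTop_atTop_of_one_lt (by norm_num)).atTop_mul_const hs
  have tT := (T_tendsto.comp t).pow 2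
  have tV := (V_tendsto.comp t).pow 2
  have lo := (tendsto_const_nhds (x := Real.pi/2)).div tT (by norm_num)
  have hi := (tendsto_const_nhds (x := Real.pi/2)).div tV (by norm_num)
  rw [one_pow, div_one] at lo hi
  have bd : ∀ n : ℕ, _ := fun n => Ie_bounds (a := Tt (2^n*s) ^ 2) (b := Vt (2^n*s) ^ 2)
    (pow_pos (V_pos (by positivity)) 2)
    (pow_le_pow_left₀ (V_pos (by positivity)).le (V_le_T (by positivity)) 2)
  simp only [iter] at bd
  exact le_antisymm (ge_of_tendsto hi (Eventually.of_forall fun n => (bd n).2))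
    (le_of_tendsto lo (Eventually.of_forall fun n => (bd n).1))

lemma K_theta_s19 {s x : ℝ} (hs : 0 < s) (hx : x ^ 2 = 1 - (Vt s ^ 2 / Tt s ^ 2) ^ 2) :
    Kint x = Real.pi / 2 * Tt s ^ 2 := by
  have h1 := T_pos hs
  have h2 := V_pos hs
  have hT : 0 < Tt s ^ 2 := by positivity
  rw [Kint_eq_Ie (b := Vt s ^ 2 / Tt s ^ 2) (by positivity) hx]
  have := Ie_scale hT 1 (Vt s ^ 2 / Tt s ^ 2)
  rw [mul_one, mul_div_cancel₀ _ hT.ne', Ie_theta hs] at this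
  rw [this]; field_simp

theorem K_main {s k : ℝ} (hs : 0 < s) (hk0 : 0 < k) (hk1 : k < 1)
    (hK : Kint (√(1 - k^2)) = s * Kint k) :
    Real.pi / (2 * √(1 - k^2) * Kint k) = 1 / Vt s ^ 2 := by
  have h1 := T_pos hs
  have h2 := V_pos hs
  have h3 := U_pos hs
  have hj := jacobi hs
  have hpi := Real.pi_pos
  set k0 := Ut s ^ 2 / Tt s ^ 2 with hk0d
  set k0' := Vt s ^ 2 / Tt s ^ 2 with hkpd
  have p0 : 0 < k0 := by positivity
  have p0' : 0 < k0' := by positivity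
  have hsq : k0 ^ 2 = 1 - k0' ^ 2 := by
    rw [hk0d, hkpd]; field_simp; linear_combination hj
  have hlt : k0 < 1 := by nlinarith [mul_pos p0' p0']
  have hlt' : k0' < 1 := by nlinarith [mul_pos p0 p0]
  have sq0 : √(1 - k0^2) = k0' := by
    rw [show 1 - k0^2 = k0'^2 by linarith, Real.sqrt_sq p0'.le]
  have K0 : Kint k0 = Real.pi / 2 * Tt s ^ 2 := K_theta_s19 hs hsq
  have K0' : Kint k0' = s * Kint k0 := by
    have i1 := T_inv hs
    have i2 := V_inv hs
    have ss := Real.sq_sqrt hs.le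
    have hss := Real.sqrt_pos.2 hs
    rw [K_theta_s19 (s := 1/s) (by positivity), K0, i1, mul_pow, ss]
    · ring
    · rw [i1, i2, mul_pow, mul_pow, mul_div_mul_left _ _ (by positivity), ← hk0d]; linarith
  have keq : k = k0 := by
    rcases lt_trichotomy k k0 with h | h | h
    · exfalso
      have a1 := K_strict hk0.le h hlt
      have a2 : k0' < √(1 - k^2) := by
        rw [← sq0]; apply Real.sqrt_lt_sqrt <;> nlinarith
      have a3 : √(1 - k^2) < 1 := by
        rw [Real.sqrt_lt' one_pos]; nlinarith
      have a4 := K_strict p0'.le a2 a3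
      nlinarith
    · exact h
    · exfalso
      have a1 := K_strict p0.le h hk1
      have a2 : √(1 - k^2) < k0' := by
        rw [← sq0]; apply Real.sqrt_lt_sqrt <;> nlinarith
      have a4 := K_strict (Real.sqrt_nonneg _) a2 hlt'
      nlinarith
  rw [keq, sq0, K0, hkpd]
  field_simp

/-- Equation (22): for `q = e^{-π√r}`, the continued fraction `u(q,q)` converges to some
`L ≠ 1` and `-1 + 2/(1 - u(q,q)) = π/(2 k'_r K(k_r))`. -/
theorem stmt_19 (r : ℝ) (hr : 0 < r) (q : ℝ) (hq : q = Real.exp (-Real.pi * Real.sqrt r))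
    (k : ℝ) (hk0 : 0 < k) (hk1 : k < 1)
    (hK : Kint (Real.sqrt (1 - k ^ 2)) = Real.sqrt r * Kint k) :
    ∃ L : ℝ,
      CFTendsto
        (fun n => if n = 1 then 2 * q else q ^ 2 * q ^ (n - 2) * (1 + q ^ (n - 1)) ^ 2)
        (fun n => 1 - q ^ (2 * n - 1)) L ∧
      L ≠ 1 ∧
      -1 + 2 / (1 - L) = Real.pi / (2 * Real.sqrt (1 - k ^ 2) * Kint k) := by
  have hs : 0 < Real.sqrt r := Real.sqrt_pos.2 hr
  have h0 : 0 < q := hq ▸ Real.exp_pos _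
  have h1 : q < 1 := hq ▸ exp_lt hs
  obtain ⟨L, hL1, hL2, hL3⟩ := cf_main h0 h1
  refine ⟨L, hL1, hL2, ?_⟩
  rw [hL3, K_main hs hk0 hk1 hK, Vt, hq]
  simp_rw [tf_eq]
end
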